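/- There exist positive constants C, β, δ (depending only on the distribution of ξ) such that for all n ≥ 1 (with P(|𝒯| = n) > 0) and all x, y ∈ Δ(β, δ), the bivariate generating function h_n satisfies |h_n(x, y)| ≤ C n |1 − x|^{−1} |1 − y|^{−1}. -/

import Mathlib

open scoped ENNReal BigOperators
open Set Filter

/-- Plane (ordered rooted) trees. -/
inductive PlaneTree : Type
  | node : List PlaneTree → PlaneTree

namespace PlaneTree

/-- The list of subtrees hanging off the root. -/
def children : PlaneTree → List PlaneTree
  | .node ts => ts

/-- The subtree rooted at a given position (sequence of child indices), if it exists. -/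
def subtreeAt : PlaneTree → List ℕ → Option PlaneTree
  | t, [] => some t
  | .node ts, i :: q =>
    match ts[i]? with
    | some t' => subtreeAt t' q
    | none => none

/-- The vertex set of a tree, with vertices identified with their positions. -/
def vertexSet (t : PlaneTree) : Set (List ℕ) := {q | (subtreeAt t q).isSome}

/-- The number of vertices of a tree. -/
noncomputable def size (t : PlaneTree) : ℕ := (vertexSet t).ncard

/-- The number of children of the vertex at position `q`. -/
def childCount (t : PlaneTree) (q : List ℕ) : ℕ :=
  ((subtreeAt t q).map fun t' => t'.children.length).getD 0

end PlaneTree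

/-- Longest common prefix of two positions; this is the position of the last common
ancestor of the two vertices. -/
def lca : List ℕ → List ℕ → List ℕ
  | a :: as, b :: bs => if a = b then a :: lca as bs else []
  | _, _ => []

/-- The distance from `v` up to the last common ancestor of `v` and `w`. -/
def dUp (v w : List ℕ) : ℕ := v.length - (lca v w).length

/-- The graph distance between the vertices at positions `v` and `w`. -/
def treeDist (v w : List ℕ) : ℕ := dUp v w + dUp w v

/-- The Galton–Watson probability of a given finite tree: the product, over all vertices,
of the probability that the offspring distribution takes the value given by the number of
children of the vertex. -/
noncomputable def gwProb (p : ℕ → ℝ≥0∞) (t : PlaneTree) : ℝ≥0∞ :=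
  ∏ᶠ v ∈ PlaneTree.vertexSet t, p (PlaneTree.childCount t v)

/-- `P(|𝒯| = n)` for the Galton–Watson tree `𝒯`. -/
noncomputable def probSize (p : ℕ → ℝ≥0∞) (n : ℕ) : ℝ≥0∞ :=
  ∑' t : PlaneTree, if PlaneTree.size t = n then gwProb p t else 0

/-- `E f(T_n)` where `T_n` is the Galton–Watson tree conditioned to have `n` vertices. -/
noncomputable def condExp (p : ℕ → ℝ≥0∞) (n : ℕ) (f : PlaneTree → ℝ≥0∞) : ℝ≥0∞ :=
  (∑' t : PlaneTree, if PlaneTree.size t = n then gwProb p t * f t else 0) / probSize p n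

/-- The variance of the offspring distribution `p` (which has mean `1`). -/
noncomputable def xiVar (p : ℕ → ℝ≥0∞) : ℝ≥0∞ :=
  ∑' k : ℕ, p k * ENNReal.ofReal (((k : ℝ) - 1) ^ 2)

/-- `P_k(t)`: the number of unordered pairs of vertices of `t` at graph distance `k`. -/
noncomputable def pairCount (t : PlaneTree) (k : ℕ) : ℕ :=
  {s : Set (List ℕ) | ∃ v w, v ∈ PlaneTree.vertexSet t ∧ w ∈ PlaneTree.vertexSet t ∧
    s = {v, w} ∧ treeDist v w = k}.ncard

/-- The singularity-analysis domain `Δ(β, δ)`. -/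
def Delta (β δ : ℝ) : Set ℂ :=
  {z : ℂ | ‖z‖ < 1 + δ ∧ z ≠ 1 ∧ Real.pi / 2 - β < |Complex.arg (z - 1)|}

/-- The bivariate generating function
`h_n(x, y) = E ∑_{v,w ∈ T_n} x^{d(v, v∧w)} y^{d(w, v∧w)}` (sum over ordered pairs). -/
noncomputable def hGen (p : ℕ → ℝ≥0∞) (n : ℕ) (x y : ℂ) : ℂ :=
  (∑' t : PlaneTree, (if PlaneTree.size t = n then (gwProb p t).toReal else 0) *
      ∑ᶠ v ∈ PlaneTree.vertexSet t, ∑ᶠ w ∈ PlaneTree.vertexSet t,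
        x ^ dUp v w * y ^ dUp w v) / (probSize p n).toReal

open scoped Topology

/-- The power series `u ↦ ∑ cₖ uᵏ` with real coefficients, as a function on `ℂ`. -/
noncomputable def pgf (c : ℕ → ℝ) (u : ℂ) : ℂ := ∑' k, (c k : ℂ) * u ^ k

/-- The coefficients of the formal derivative of `∑ cₖ uᵏ`. -/
def dcoeff (c : ℕ → ℝ) (k : ℕ) : ℝ := (k + 1) * c (k + 1)

section Pgf

variable {c : ℕ → ℝ}

lemma dcoeff_nonneg (hc : ∀ k, 0 ≤ c k) (k : ℕ) : 0 ≤ dcoeff c k :=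
  mul_nonneg (by positivity) (hc _)

lemma norm_pgf_term_le (hc : ∀ k, 0 ≤ c k) {u : ℂ} (hu : ‖u‖ ≤ 1) (k : ℕ) :
    ‖(c k : ℂ) * u ^ k‖ ≤ c k := by
  rw [norm_mul, norm_pow, Complex.norm_real, Real.norm_of_nonneg (hc k)]
  exact mul_le_of_le_one_right (hc k) (pow_le_one₀ (norm_nonneg _) hu)

lemma hasSum_pgf (hc : ∀ k, 0 ≤ c k) (hs : Summable c) {u : ℂ} (hu : ‖u‖ ≤ 1) :
    HasSum (fun k => (c k : ℂ) * u ^ k) (pgf c u) :=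
  (Summable.of_norm_bounded hs (norm_pgf_term_le hc hu)).hasSum

lemma norm_pgf_le (hc : ∀ k, 0 ≤ c k) (hs : Summable c) {u : ℂ} (hu : ‖u‖ ≤ 1) :
    ‖pgf c u‖ ≤ ∑' k, c k :=
  tsum_of_norm_bounded hs.hasSum (norm_pgf_term_le hc hu)

lemma continuousOn_pgf (hc : ∀ k, 0 ≤ c k) (hs : Summable c) :
    ContinuousOn (pgf c) (Metric.closedBall 0 1) :=
  continuousOn_tsum (fun k => by fun_prop) hs
    fun k u hu => norm_pgf_term_le hc (by simpa using hu) k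

lemma pgf_one : pgf c 1 = ((∑' k, c k : ℝ) : ℂ) := by
  simp [pgf, Complex.ofReal_tsum]

lemma hasDerivAt_pgf (hc : ∀ k, 0 ≤ c k) (hs : Summable c) {u : ℂ} (hu : ‖u‖ < 1) :
    HasDerivAt (pgf c) (pgf (dcoeff c) u) u := by
  obtain ⟨r, hur, hr⟩ := exists_between hu
  have hr0 : 0 < r := (norm_nonneg u).trans_lt hur
  have hbound : Summable fun k : ℕ => (∑' k, c k) * (k * r ^ (k - 1)) := by
    refine Summable.mul_left _ ?_
    have h := (summable_pow_mul_geometric_of_norm_lt_one (R := ℝ) 1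
      (r := r) (by rwa [Real.norm_of_nonneg hr0.le])).mul_left r⁻¹
    refine h.congr fun k => ?_
    rcases k with _ | k
    · simp
    · simp only [Nat.add_sub_cancel, pow_succ]; field_simp
  have key := hasDerivAt_tsum_of_isPreconnected (g := fun k (v : ℂ) => (c k : ℂ) * v ^ k)
    (g' := fun k v => (c k : ℂ) * (k * v ^ (k - 1))) hbound (Metric.isOpen_ball (x := 0) (ε := r))
    (convex_ball _ _).isPreconnected
    (fun k v _ => (hasDerivAt_pow k v).const_mul _) (fun k v hv => by
      rw [norm_mul, norm_mul, norm_pow, Complex.norm_real, Real.norm_of_nonneg (hc k),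
        Complex.norm_natCast]
      have : ‖v‖ ≤ r := by simpa using (le_of_lt (mem_ball_zero_iff.1 hv))
      have h0 := hs.le_tsum k fun j _ => hc j
      gcongr
      exact (hc k).trans h0) (y₀ := 0) (by simpa using hr0)
    (hasSum_pgf hc hs (by simp)).summable (y := u) (by simpa using hur)
  have hsum : Summable fun k : ℕ => (c k : ℂ) * (k * u ^ (k - 1)) := by
    refine Summable.of_norm_bounded hbound fun k => ?_
    rw [norm_mul, norm_mul, norm_pow, Complex.norm_real, Real.norm_of_nonneg (hc k),
        Complex.norm_natCast]
    have h0 := hs.le_tsum k fun j _ => hc j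
    gcongr
    exact (hc k).trans h0
  have heq : pgf (dcoeff c) u = ∑' k : ℕ, (c k : ℂ) * (k * u ^ (k - 1)) := by
    rw [hsum.tsum_eq_zero_add]
    simp only [pgf, dcoeff]
    push_cast
    simp only [zero_mul, mul_zero, zero_add]
    exact tsum_congr fun k => by ring
  rw [heq]
  exact key

lemma norm_pgf_dcoeff_le (hc : ∀ k, 0 ≤ c k) (hs : Summable c) {u : ℂ} (hu : ‖u‖ < 1) :
    ‖pgf (dcoeff c) u‖ * (1 - ‖u‖) ≤ ∑' k, c k := by
  have h1 : 0 < 1 - ‖u‖ := by linarith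
  rw [← le_div_iff₀ h1]
  have hb : ∀ k : ℕ, ((k : ℝ) + 1) * ‖u‖ ^ k ≤ 1 / (1 - ‖u‖) := by
    intro k
    rw [le_div_iff₀ h1]
    have hg : (∑ i ∈ Finset.range (k + 1), ‖u‖ ^ i) * (1 - ‖u‖) ≤ 1 := by
      rw [geom_sum_mul_neg]; linarith [pow_nonneg (norm_nonneg u) (k + 1)]
    refine le_trans ?_ hg
    gcongr
    have : ∑ i ∈ Finset.range (k + 1), ‖u‖ ^ k ≤ ∑ i ∈ Finset.range (k + 1), ‖u‖ ^ i :=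
      Finset.sum_le_sum fun i hi => pow_le_pow_of_le_one (norm_nonneg _) hu.le
        (by simp at hi; omega)
    simpa using this
  have hs' : Summable fun k => c (k + 1) := (summable_nat_add_iff 1).2 hs
  have : ‖pgf (dcoeff c) u‖ ≤ (∑' k, c (k + 1)) * (1 / (1 - ‖u‖)) := by
    refine tsum_of_norm_bounded (hs'.hasSum.mul_right _) fun k => ?_
    rw [norm_mul, norm_pow, Complex.norm_real, Real.norm_of_nonneg (dcoeff_nonneg hc k), dcoeff,
      mul_comm _ (c (k + 1)), mul_assoc]
    exact mul_le_mul_of_nonneg_left (hb k) (hc _)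
  refine this.trans ?_
  rw [mul_one_div, hs.tsum_eq_zero_add]
  gcongr
  linarith [hc 0]

/-- First order expansion at `1` in the closed unit disc. -/
lemma exists_pgf_eq_add_mul (hc : ∀ k, 0 ≤ c k) (hs : Summable c) (hd : Summable (dcoeff c)) :
    ∃ R : ℂ → ℂ, ContinuousOn R (Metric.closedBall 0 1) ∧
      R 1 = ((∑' k, dcoeff c k : ℝ) : ℂ) ∧
      ∀ u : ℂ, ‖u‖ ≤ 1 → pgf c u = ((∑' k, c k : ℝ) : ℂ) + (u - 1) * R u := by
  have hkc : Summable fun k : ℕ => (k : ℝ) * c k := by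
    rw [← summable_nat_add_iff 1]
    exact hd.congr fun k => by simp [dcoeff]
  have hterm : ∀ (k : ℕ) (u : ℂ), ‖u‖ ≤ 1 →
      ‖(c k : ℂ) * ∑ j ∈ Finset.range k, u ^ j‖ ≤ k * c k := by
    intro k u hu
    rw [norm_mul, Complex.norm_real, Real.norm_of_nonneg (hc k), mul_comm]
    refine mul_le_mul_of_nonneg_right ?_ (hc k)
    refine (norm_sum_le_of_le (f := fun j => u ^ j) (n := fun _ => 1) _ fun j _ => ?_).trans
      (by simp)
    rw [norm_pow]; exact pow_le_one₀ (norm_nonneg _) hu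
  refine ⟨fun u => ∑' k : ℕ, (c k : ℂ) * ∑ j ∈ Finset.range k, u ^ j,
    continuousOn_tsum (fun k => by fun_prop) hkc fun k u hu => hterm k u (by simpa using hu),
    ?_, fun u hu => ?_⟩
  · rw [Complex.ofReal_tsum]
    have : Summable fun k : ℕ => (c k : ℂ) * ∑ j ∈ Finset.range k, (1 : ℂ) ^ j :=
      Summable.of_norm_bounded hkc fun k => hterm k 1 (by simp)
    beta_reduce
    rw [this.tsum_eq_zero_add]
    simp only [dcoeff, one_pow, Finset.sum_const, Finset.card_range, nsmul_eq_mul, mul_one]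
    push_cast
    simp only [mul_zero, zero_add]
    exact tsum_congr fun k => by ring
  · have h1 : HasSum (fun k : ℕ => (c k : ℂ) * ∑ j ∈ Finset.range k, u ^ j) _ :=
      (Summable.of_norm_bounded hkc fun k => hterm k u hu).hasSum
    have h2 : HasSum (fun k => (c k : ℂ)) ((∑' k, c k : ℝ) : ℂ) := Complex.hasSum_ofReal.2 hs.hasSum
    refine (hasSum_pgf hc hs hu).unique ?_
    convert! h2.add (h1.mul_left (u - 1)) using 2 with k
    have := geom_sum_mul u k
    linear_combination (-(c k : ℂ)) * this

/-- Second order expansion at `1` in the closed unit disc. -/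
lemma exists_pgf_eq_add_mul_add_sq_mul (hc : ∀ k, 0 ≤ c k) (hs : Summable c)
    (hd : Summable (dcoeff c)) (hdd : Summable (dcoeff (dcoeff c))) :
    ∃ R : ℂ → ℂ, ContinuousOn R (Metric.closedBall 0 1) ∧
      R 1 = ((∑' k, dcoeff (dcoeff c) k : ℝ) : ℂ) / 2 ∧
      (∀ r : ℝ, 0 ≤ r → r ≤ 1 → 0 < ∑' k, dcoeff (dcoeff c) k → R r ≠ 0) ∧
      ∀ u : ℂ, ‖u‖ ≤ 1 → pgf c u = ((∑' k, c k : ℝ) : ℂ) + (u - 1) * ((∑' k, dcoeff c k : ℝ) : ℂ)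
        + (u - 1) ^ 2 * R u := by
  set P : ℕ → ℂ → ℂ := fun k u => ∑ i ∈ Finset.range k, ∑ j ∈ Finset.range i, u ^ j with hP
  have hkc : Summable fun k : ℕ => (k : ℝ) * c k := by
    rw [← summable_nat_add_iff 1]
    exact hd.congr fun k => by simp [dcoeff]
  have hkkc : Summable fun k : ℕ => ((k : ℝ) * (k - 1) / 2) * c k := by
    rw [← summable_nat_add_iff 2]
    exact (hdd.div_const 2).congr fun k => by simp [dcoeff]; ring_nf
  have hPle : ∀ (k : ℕ) (u : ℂ), ‖u‖ ≤ 1 → ‖P k u‖ ≤ (k : ℝ) * (k - 1) / 2 := by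
    intro k u hu
    have h1 : ‖P k u‖ ≤ ∑ i ∈ Finset.range k, (i : ℝ) :=
      norm_sum_le_of_le _ fun i _ =>
        (norm_sum_le_of_le (f := fun j => u ^ j) (n := fun _ => (1 : ℝ)) _ fun j _ => by
          rw [norm_pow]; exact pow_le_one₀ (norm_nonneg _) hu).trans (by simp)
    have h2 : ∀ m : ℕ, ∑ i ∈ Finset.range m, (i : ℝ) = (m : ℝ) * (m - 1) / 2 := by
      intro m
      induction m with
      | zero => simp
      | succ m ih => rw [Finset.sum_range_succ, ih]; push_cast; ring
    rwa [h2] at h1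
  have hPone : ∀ k : ℕ, P k 1 = (((k : ℝ) * (k - 1) / 2 : ℝ) : ℂ) := by
    intro k
    induction k with
    | zero => simp [hP]
    | succ m ih =>
      have : P (m + 1) 1 = P m 1 + m := by simp [hP, Finset.sum_range_succ]
      rw [this, ih]; push_cast; ring
  have hPid : ∀ (k : ℕ) (u : ℂ), u ^ k = 1 + k * (u - 1) + (u - 1) ^ 2 * P k u := by
    intro k u
    induction k with
    | zero => simp [hP]
    | succ m ih =>
      have h1 : P (m + 1) u = P m u + ∑ j ∈ Finset.range m, u ^ j := by
        simp [hP, Finset.sum_range_succ]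
      have h2 : u ^ (m + 1) = u ^ m + (u - 1) + (u - 1) * (u ^ m - 1) := by ring
      rw [h2, h1, ← geom_sum_mul, ih]; push_cast; ring
  have hterm : ∀ (k : ℕ) (u : ℂ), ‖u‖ ≤ 1 →
      ‖(c k : ℂ) * P k u‖ ≤ ((k : ℝ) * (k - 1) / 2) * c k := by
    intro k u hu
    rw [norm_mul, Complex.norm_real, Real.norm_of_nonneg (hc k), mul_comm]
    exact mul_le_mul_of_nonneg_right (hPle k u hu) (hc k)
  refine ⟨fun u => ∑' k : ℕ, (c k : ℂ) * P k u,
    continuousOn_tsum (fun k => by fun_prop) hkkc fun k u hu => hterm k u (by simpa using hu),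
    ?_, fun r hr0 hr1 hpos => ?_, fun u hu => ?_⟩
  · have h : ∑' k, dcoeff (dcoeff c) k = 2 * ∑' k : ℕ, ((k : ℝ) * (k - 1) / 2) * c k := by
      rw [← tsum_mul_left, ← (hkkc.mul_left 2).sum_add_tsum_nat_add 2]
      simp only [Finset.sum_range_succ, Finset.sum_range_zero]
      norm_num
      exact tsum_congr fun k => by simp only [dcoeff]; push_cast; ring
    rw [h]
    simp only [hPone]
    push_cast [Complex.ofReal_tsum]
    rw [mul_div_cancel_left₀ _ two_ne_zero]
    exact tsum_congr fun k => by ring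
  · set Q : ℕ → ℝ := fun k => ∑ i ∈ Finset.range k, ∑ j ∈ Finset.range i, r ^ j with hQ
    have hPQ : ∀ k, P k r = Q k := by intro k; simp [hP, hQ]
    have hQ0 : ∀ k, 0 ≤ Q k := fun k => by positivity
    have hsQ : Summable fun k => c k * Q k := by
      have := Summable.of_norm_bounded hkkc fun k => hterm k r
        (by rw [Complex.norm_real, Real.norm_of_nonneg hr0]; exact hr1)
      simp only [hPQ, ← Complex.ofReal_mul] at this
      exact Complex.summable_ofReal.1 this
    obtain ⟨k, hk⟩ : ∃ k, 0 < c (k + 2) := by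
      by_contra! hcon
      have : ∀ k, dcoeff (dcoeff c) k = 0 := fun k => by
        have : c (k + 1 + 1) = 0 := le_antisymm (hcon k) (hc _)
        simp [dcoeff, this]
      simp [this] at hpos
    have hQk : 1 ≤ Q (k + 2) := by
      have h1 : ∑ j ∈ Finset.range 1, r ^ j ≤ Q (k + 2) :=
        Finset.single_le_sum (f := fun i => ∑ j ∈ Finset.range i, r ^ j)
          (fun i _ => by positivity) (by simp)
      simpa using h1
    have hpos' : 0 < ∑' k, c k * Q k :=
      hsQ.tsum_pos (fun k => mul_nonneg (hc k) (hQ0 k)) (k + 2) (by positivity)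
    simp only [hPQ, ← Complex.ofReal_mul, ← Complex.ofReal_tsum]
    exact_mod_cast hpos'.ne'
  · have h1 : HasSum (fun k : ℕ => (c k : ℂ) * P k u) _ :=
      (Summable.of_norm_bounded hkkc fun k => hterm k u hu).hasSum
    have h2 : HasSum (fun k => (c k : ℂ)) ((∑' k, c k : ℝ) : ℂ) := Complex.hasSum_ofReal.2 hs.hasSum
    have h3 : HasSum (fun k : ℕ => (((k : ℝ) * c k : ℝ) : ℂ)) ((∑' k, dcoeff c k : ℝ) : ℂ) := by
      refine Complex.hasSum_ofReal.2 ?_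
      have := hkc.hasSum
      rw [hkc.tsum_eq_zero_add] at this
      simpa [dcoeff] using this
    refine (hasSum_pgf hc hs hu).unique ?_
    convert! (h2.add (h3.mul_left (u - 1))).add (h1.mul_left ((u - 1) ^ 2)) using 2 with k
    rw [hPid k u]; push_cast; ring

end Pgf

/-- `f` is given by the power series `∑ bₙ zⁿ` near the origin. -/
def HasCoeffs (f : ℂ → ℂ) (b : ℕ → ℂ) : Prop :=
  ∀ᶠ z in 𝓝 (0 : ℂ), HasSum (fun n => b n * z ^ n) (f z)

section HasCoeffs

variable {f g : ℂ → ℂ} {b c : ℕ → ℂ}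

lemma HasCoeffs.hasFPowerSeriesAt (h : HasCoeffs f b) :
    HasFPowerSeriesAt f (.ofScalars ℂ b) 0 := by
  rw [hasFPowerSeriesAt_iff]
  filter_upwards [h] with z hz
  simpa [FormalMultilinearSeries.coeff_ofScalars, mul_comm] using hz

lemma HasCoeffs.of_analyticAt (h : AnalyticAt ℂ f 0) : ∃ b, HasCoeffs f b := by
  obtain ⟨p, hp⟩ := h
  refine ⟨p.coeff, ?_⟩
  rw [hasFPowerSeriesAt_iff] at hp
  filter_upwards [hp] with z hz
  simpa [mul_comm] using hz

lemma HasCoeffs.factorial_mul (h : HasCoeffs f b) (n : ℕ) :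
    (n.factorial : ℂ) * b n = iteratedDeriv n f 0 := by
  obtain ⟨r, hr⟩ := h.hasFPowerSeriesAt
  have := hr.factorial_smul (1 : ℂ) n
  rw [iteratedDeriv_eq_iteratedFDeriv]
  simpa using this

lemma HasCoeffs.deriv (h : HasCoeffs f b) :
    HasCoeffs (deriv f) fun n => (n + 1) * b (n + 1) := by
  obtain ⟨b', hb'⟩ := HasCoeffs.of_analyticAt h.hasFPowerSeriesAt.analyticAt.deriv
  convert hb' using 2 with n
  have h1 := h.factorial_mul (n + 1)
  have h2 := hb'.factorial_mul n
  rw [iteratedDeriv_succ', ← h2, Nat.factorial_succ] at h1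
  have : (n.factorial : ℂ) ≠ 0 := by exact_mod_cast n.factorial_ne_zero
  push_cast at h1
  refine mul_left_cancel₀ this ?_
  linear_combination h1

lemma HasCoeffs.sub (hf : HasCoeffs f b) (hg : HasCoeffs g c) :
    HasCoeffs (fun z => f z - g z) fun n => b n - c n := by
  filter_upwards [hf, hg] with z h1 h2
  simpa [sub_mul] using h1.sub h2

lemma HasCoeffs.norm_le (h : HasCoeffs f b) (hf : DifferentiableOn ℂ f (Metric.ball 0 1))
    {r : ℝ} (hr0 : 0 < r) (hr1 : r < 1) (n : ℕ) :
    ‖b n‖ ≤ ((2 * Real.pi)⁻¹ * ∫ θ : ℝ in 0..2 * Real.pi, ‖f (circleMap 0 r θ)‖) * r⁻¹ ^ n := by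
  lift r to NNReal using hr0.le
  have h1 := (hf.mono (Metric.closedBall_subset_ball hr1)).hasFPowerSeriesOnBall
    (by exact_mod_cast hr0)
  have h2 := h.hasFPowerSeriesAt.eq_formalMultilinearSeries h1.hasFPowerSeriesAt
  have h3 := norm_cauchyPowerSeries_le f 0 r n
  rw [← h2, FormalMultilinearSeries.norm_apply_eq_norm_coef, FormalMultilinearSeries.coeff_ofScalars,
    abs_of_pos hr0] at h3
  exact h3

end HasCoeffs

lemma le_norm_one_sub_mul_exp {ρ θ : ℝ} (h0 : 0 ≤ ρ) (h1 : ρ < 1) (hθ : |θ| ≤ Real.pi) :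
    (1 - ρ + |θ|) / 10 ≤ ‖1 - (ρ : ℂ) * Complex.exp (θ * Complex.I)‖ := by
  have hpi := Real.pi_lt_d2
  have hpi0 := Real.pi_pos
  have hsq : ‖1 - (ρ : ℂ) * Complex.exp (θ * Complex.I)‖ ^ 2
      = (1 - ρ) ^ 2 + 2 * ρ * (1 - Real.cos θ) := by
    rw [← Complex.normSq_eq_norm_sq, Complex.normSq_apply]
    simp [Complex.exp_re, Complex.exp_im]
    nlinarith [Real.sin_sq_add_cos_sq θ]
  have hcos := Real.cos_le_one_sub_mul_cos_sq hθ
  have hmul : 2 / Real.pi ^ 2 * θ ^ 2 ≥ θ ^ 2 / 5 := by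
    have : (1 : ℝ) / 5 ≤ 2 / Real.pi ^ 2 := by
      rw [div_le_div_iff₀ (by norm_num) (by positivity)]; nlinarith
    nlinarith [sq_nonneg θ]
  refine abs_le_of_sq_le_sq' ?_ (norm_nonneg _) |>.2
  rw [hsq]
  have ha : |θ| ^ 2 = θ ^ 2 := sq_abs θ
  have hb := abs_nonneg θ
  rcases le_total ρ (1 / 2) with h | h
  · nlinarith [Real.cos_le_one θ]
  · nlinarith [Real.cos_le_one θ, sq_nonneg (1 - ρ - |θ|)]

lemma integral_inv_sqrt_pow_three_le_of_le {f : ℝ → ℝ} {ε : ℝ} (hε : 0 < ε)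
    (hf : Continuous f) (hle : ∀ θ ∈ Icc 0 Real.pi, (ε + θ) / 10 ≤ f θ) :
    ∫ θ in (0)..Real.pi, (√(f θ) ^ 3)⁻¹ ≤ 80 / √ε := by
  have hpos : ∀ θ ∈ Icc 0 Real.pi, 0 < ε + θ := fun θ hθ => by linarith [hθ.1]
  have huIcc : uIcc 0 Real.pi = Icc 0 Real.pi := uIcc_of_le Real.pi_pos.le
  have hcont : ContinuousOn (fun θ => (√(ε + θ) ^ 3)⁻¹) (Icc 0 Real.pi) := by
    refine ContinuousOn.inv₀ (by fun_prop) fun θ hθ => ?_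
    have := Real.sqrt_pos.2 (hpos θ hθ)
    positivity
  have hint : ∫ θ in (0)..Real.pi, (√(ε + θ) ^ 3)⁻¹ ≤ 2 / √ε := by
    have := intervalIntegral.integral_eq_sub_of_hasDerivAt (a := 0) (b := Real.pi)
      (f := fun θ => -2 * (√(ε + θ))⁻¹) (f' := fun θ => (√(ε + θ) ^ 3)⁻¹) (fun θ hθ => by
        rw [huIcc] at hθ
        have h1 := hpos θ hθ
        have h2 : √(ε + θ) ≠ 0 := (Real.sqrt_pos.2 h1).ne'
        have h3 := (((hasDerivAt_id' θ).const_add ε).sqrt h1.ne').inv h2 |>.const_mul (-2)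
        convert! h3 using 1
        field_simp) (by
        apply ContinuousOn.intervalIntegrable
        rwa [huIcc])
    rw [this, add_zero, div_eq_mul_inv]
    have : 0 ≤ (√(ε + Real.pi))⁻¹ := by positivity
    linarith
  have hmono : ∫ θ in (0)..Real.pi, (√(f θ) ^ 3)⁻¹
      ≤ ∫ θ in (0)..Real.pi, 40 * (√(ε + θ) ^ 3)⁻¹ := by
    refine intervalIntegral.integral_mono_on Real.pi_pos.le ?_ ?_ fun θ hθ => ?_
    · apply ContinuousOn.intervalIntegrable
      rw [huIcc]
      refine ContinuousOn.inv₀ (by fun_prop) fun θ hθ => ?_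
      have := Real.sqrt_pos.2 ((div_pos (hpos θ hθ) (by norm_num)).trans_le (hle θ hθ))
      positivity
    · apply ContinuousOn.intervalIntegrable
      rw [huIcc]
      exact hcont.const_smul (40 : ℝ)
    · have h1 := Real.sqrt_pos.2 (hpos θ hθ)
      have h2 : √(ε + θ) / √10 ≤ √(f θ) := by
        rw [← Real.sqrt_div (hpos θ hθ).le]
        exact Real.sqrt_le_sqrt (hle θ hθ)
      have h3 : √10 ^ 3 ≤ 40 := by
        have h4 : √(10 : ℝ) ^ 2 = 10 := Real.sq_sqrt (by norm_num)
        have h5 : √(10 : ℝ) ≤ 4 := Real.sqrt_le_iff.2 ⟨by norm_num, by norm_num⟩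
        nlinarith
      calc (√(f θ) ^ 3)⁻¹ ≤ ((√(ε + θ) / √10) ^ 3)⁻¹ := by gcongr
        _ = √10 ^ 3 * (√(ε + θ) ^ 3)⁻¹ := by rw [div_pow, inv_div, div_eq_mul_inv]
        _ ≤ 40 * (√(ε + θ) ^ 3)⁻¹ := by gcongr
  rw [intervalIntegral.integral_const_mul] at hmono
  calc _ ≤ _ := hmono
    _ ≤ 40 * (2 / √ε) := by gcongr
    _ = 80 / √ε := by ring

lemma continuous_inv_sqrt_norm_one_sub {ρ : ℝ} (h0 : 0 ≤ ρ) (h1 : ρ < 1) :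
    Continuous fun θ : ℝ => (√‖1 - (ρ : ℂ) * Complex.exp (θ * Complex.I)‖ ^ 3)⁻¹ := by
  refine Continuous.inv₀ (by fun_prop) fun θ => ?_
  have : 1 - (ρ : ℂ) * Complex.exp (θ * Complex.I) ≠ 0 := fun h => by
    have h2 : ‖(ρ : ℂ) * Complex.exp (θ * Complex.I)‖ = 1 := by
      rw [← sub_eq_zero.1 h, norm_one]
    rw [norm_mul, Complex.norm_exp_ofReal_mul_I, mul_one, Complex.norm_real,
      Real.norm_of_nonneg h0] at h2
    linarith
  have := Real.sqrt_pos.2 (norm_pos_iff.2 this)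
  positivity

lemma integral_inv_sqrt_pow_three_le {ρ : ℝ} (h0 : 0 ≤ ρ) (h1 : ρ < 1) :
    ∫ θ in (-Real.pi)..Real.pi,
      (√‖1 - (ρ : ℂ) * Complex.exp (θ * Complex.I)‖ ^ 3)⁻¹ ≤ 160 / √(1 - ρ) := by
  have hc := continuous_inv_sqrt_norm_one_sub h0 h1
  rw [← intervalIntegral.integral_add_adjacent_intervals (b := 0)
    (hc.intervalIntegrable _ _) (hc.intervalIntegrable _ _)]
  have hneg := intervalIntegral.integral_comp_neg (a := 0) (b := Real.pi)
    (fun θ : ℝ => (√‖1 - (ρ : ℂ) * Complex.exp (θ * Complex.I)‖ ^ 3)⁻¹)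
  rw [neg_zero] at hneg
  rw [← hneg]
  have h2 := integral_inv_sqrt_pow_three_le_of_le (ε := 1 - ρ) (by linarith)
    (f := fun θ => ‖1 - (ρ : ℂ) * Complex.exp (θ * Complex.I)‖) (by fun_prop) fun θ hθ => by
      have := le_norm_one_sub_mul_exp h0 h1 (θ := θ) (by rw [abs_of_nonneg hθ.1]; exact hθ.2)
      rwa [abs_of_nonneg hθ.1] at this
  have h3 := integral_inv_sqrt_pow_three_le_of_le (ε := 1 - ρ) (by linarith)
    (f := fun θ => ‖1 - (ρ : ℂ) * Complex.exp ((-θ : ℝ) * Complex.I)‖) (by fun_prop) fun θ hθ => by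
      have := le_norm_one_sub_mul_exp h0 h1 (θ := -θ)
        (by rw [abs_neg, abs_of_nonneg hθ.1]; exact hθ.2)
      rwa [abs_neg, abs_of_nonneg hθ.1] at this
  have h4 : 160 / √(1 - ρ) = 80 / √(1 - ρ) + 80 / √(1 - ρ) := by ring
  rw [h4]
  exact add_le_add h3 h2

lemma integral_circleMap_inv_sqrt_le {r : ℝ} (h0 : 0 < r) (h1 : r < 1) {d : ℕ} (hd : d ≠ 0) :
    ∫ θ in (0)..2 * Real.pi, (√‖1 - circleMap 0 r θ ^ d‖ ^ 3)⁻¹ ≤ 160 / √(1 - r) := by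
  have hr0 : 0 ≤ r ^ d := by positivity
  have hr1 : r ^ d < 1 := pow_lt_one₀ h0.le h1 hd
  set φ : ℝ → ℝ := fun θ => (√‖1 - ((r ^ d : ℝ) : ℂ) * Complex.exp (θ * Complex.I)‖ ^ 3)⁻¹ with hφ
  have hper : Function.Periodic φ (2 * Real.pi) := fun θ => by
    simp only [hφ]
    have : (((θ + 2 * Real.pi : ℝ) : ℂ) * Complex.I)
        = θ * Complex.I + 2 * Real.pi * Complex.I := by
      push_cast; ring
    rw [this, Complex.exp_periodic]
  have hint : ∫ θ in (0)..2 * Real.pi, (√‖1 - circleMap 0 r θ ^ d‖ ^ 3)⁻¹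
      = ∫ θ in (-Real.pi)..Real.pi, φ θ := by
    have e1 : ∀ θ : ℝ, (√‖1 - circleMap 0 r θ ^ d‖ ^ 3)⁻¹ = φ (d * θ) := fun θ => by
      rw [circleMap_zero_pow, circleMap_zero]
    simp only [e1]
    have hd' : (d : ℝ) ≠ 0 := by exact_mod_cast hd
    rw [intervalIntegral.integral_comp_mul_left φ hd', mul_zero]
    have h2 := hper.intervalIntegral_add_zsmul_eq d 0
      (fun a b => (continuous_inv_sqrt_norm_one_sub hr0 hr1).intervalIntegrable a b)
    have h3 := hper.intervalIntegral_add_eq 0 (-Real.pi)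
    have e2 : -Real.pi + 2 * Real.pi = Real.pi := by ring
    rw [e2] at h3
    simp only [zero_add, zsmul_eq_mul, Int.cast_natCast] at h2 h3
    rw [h2, h3]
    simp [hd']
  rw [hint]
  refine (integral_inv_sqrt_pow_three_le hr0 hr1).trans ?_
  have h4 : r ^ d ≤ r := pow_le_of_le_one h0.le h1.le hd
  have h5 : 0 < √(1 - r) := Real.sqrt_pos.2 (by linarith)
  gcongr

/-- Transfer of a bound of order `|1 - zᵈ|^(-3/2)` in the unit disc to the coefficients. -/
lemma HasCoeffs.norm_le_sqrt {f : ℂ → ℂ} {b : ℕ → ℂ} (h : HasCoeffs f b)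
    (hf : DifferentiableOn ℂ f (Metric.ball 0 1)) {d : ℕ} (hd : d ≠ 0) {M M' : ℝ} (hM : 0 ≤ M)
    (hM' : 0 ≤ M') (hle : ∀ z : ℂ, ‖z‖ < 1 → ‖f z‖ ≤ M * (√‖1 - z ^ d‖ ^ 3)⁻¹ + M')
    {m n : ℕ} (hn : 1 ≤ n) (hmn : m ≤ n) : ‖b m‖ ≤ 200 * M * √n + 3 * M' := by
  have hn' : (1 : ℝ) ≤ n := by exact_mod_cast hn
  set r : ℝ := n / (n + 1) with hr
  have hr0 : 0 < r := by positivity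
  have hr1 : r < 1 := by rw [hr, div_lt_one (by positivity)]; linarith
  have h1r : 1 - r = 1 / (n + 1) := by rw [hr]; field_simp; ring
  have hpow : r⁻¹ ^ m ≤ 3 := by
    have hinv : r⁻¹ = 1 + 1 / n := by rw [hr]; field_simp
    calc r⁻¹ ^ m ≤ r⁻¹ ^ n := pow_le_pow_right₀ ((one_le_inv₀ hr0).2 hr1.le) hmn
      _ ≤ Real.exp (1 / n) ^ n := by
        rw [hinv]; gcongr; linarith [Real.add_one_le_exp (1 / (n : ℝ))]
      _ = Real.exp 1 := by rw [← Real.exp_nat_mul]; congr 1; field_simp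
      _ ≤ 3 := by linarith [Real.exp_one_lt_d9]
  have hmem : ∀ θ, ‖circleMap 0 r θ‖ < 1 := fun θ => by
    rwa [norm_circleMap_zero, abs_of_pos hr0]
  have hcm : Continuous (circleMap 0 r) := continuous_circleMap 0 r
  have hcf : Continuous fun θ => ‖f (circleMap 0 r θ)‖ :=
    (hf.continuousOn.comp_continuous hcm fun θ => by simpa using hmem θ).norm
  have hcg : Continuous fun θ => (√‖1 - circleMap 0 r θ ^ d‖ ^ 3)⁻¹ := by
    refine Continuous.inv₀ (by fun_prop) fun θ => ?_
    have : 1 - circleMap 0 r θ ^ d ≠ 0 := fun h => by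
      have h2 : ‖circleMap 0 r θ ^ d‖ = 1 := by rw [← sub_eq_zero.1 h, norm_one]
      rw [norm_pow] at h2
      exact (pow_lt_one₀ (norm_nonneg _) (hmem θ) hd).ne h2
    have := Real.sqrt_pos.2 (norm_pos_iff.2 this)
    positivity
  have hI : ∫ θ : ℝ in 0..2 * Real.pi, ‖f (circleMap 0 r θ)‖
      ≤ M * (160 / √(1 - r)) + M' * (2 * Real.pi) := by
    calc _ ≤ ∫ θ : ℝ in 0..2 * Real.pi, (M * (√‖1 - circleMap 0 r θ ^ d‖ ^ 3)⁻¹ + M') :=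
          intervalIntegral.integral_mono_on Real.two_pi_pos.le (hcf.intervalIntegrable _ _)
            (((continuous_const.mul hcg).add continuous_const).intervalIntegrable _ _)
            fun θ _ => hle _ (hmem θ)
      _ = M * (∫ θ : ℝ in 0..2 * Real.pi, (√‖1 - circleMap 0 r θ ^ d‖ ^ 3)⁻¹)
          + M' * (2 * Real.pi) := by
        rw [intervalIntegral.integral_add ((hcg.intervalIntegrable _ _).const_mul M) (by simp),
          intervalIntegral.integral_const_mul, intervalIntegral.integral_const]
        simp [mul_comm]
      _ ≤ _ := by gcongr; exact integral_circleMap_inv_sqrt_le hr0 hr1 hd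
  have hsq : 160 / √(1 - r) ≤ 240 * √n := by
    rw [h1r, Real.sqrt_div zero_le_one, Real.sqrt_one, div_div_eq_mul_div, div_one]
    have : √((n : ℝ) + 1) ≤ 1.5 * √n := by
      rw [Real.sqrt_le_left (by positivity), mul_pow, Real.sq_sqrt (by positivity)]
      linarith
    linarith
  have hpi := Real.pi_gt_three
  have h6 := h.norm_le hf hr0 hr1 m
  refine h6.trans ?_
  have hX : (2 * Real.pi)⁻¹ * ∫ θ : ℝ in 0..2 * Real.pi, ‖f (circleMap 0 r θ)‖
      ≤ 40 * M * √n + M' := by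
    rw [inv_mul_le_iff₀ Real.two_pi_pos]
    refine hI.trans ?_
    have h7 : 0 ≤ M * √n := by positivity
    have h8 : M * (160 / √(1 - r)) ≤ M * (240 * √n) := by gcongr
    nlinarith
  have h9 : 0 ≤ M * √n := by positivity
  calc _ ≤ (40 * M * √n + M') * 3 := by gcongr
    _ ≤ _ := by nlinarith

/-- The coefficients of `(1 - z)^(-3/2)`. -/
noncomputable def threeHalvesCoeff (n : ℕ) : ℝ := ∏ i ∈ Finset.range n, ((3 / 2 + i) / (i + 1))

lemma sqrt_le_threeHalvesCoeff (n : ℕ) : √(n + 1) ≤ threeHalvesCoeff n := by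
  have hnn : ∀ n, 0 ≤ threeHalvesCoeff n := fun n => Finset.prod_nonneg fun i _ => by positivity
  rw [Real.sqrt_le_left (hnn n)]
  induction n with
  | zero => simp [threeHalvesCoeff]
  | succ n ih =>
    have : threeHalvesCoeff (n + 1) = threeHalvesCoeff n * ((3 / 2 + n) / (n + 1)) :=
      Finset.prod_range_succ _ _
    rw [this, mul_pow]
    calc ((n + 1 : ℕ) : ℝ) + 1 ≤ (n + 1) * ((3 / 2 + n) / (n + 1)) ^ 2 := by
          rw [div_pow, mul_div_assoc', le_div_iff₀ (by positivity)]
          push_cast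
          nlinarith [(Nat.cast_nonneg n : (0 : ℝ) ≤ n)]
      _ ≤ _ := by gcongr

lemma multichoose_threeHalves (n : ℕ) :
    Ring.multichoose (3 / 2 : ℂ) n = (threeHalvesCoeff n : ℂ) := by
  have hasc : ∀ n, (n.factorial : ℂ) * Ring.multichoose (3 / 2 : ℂ) n
      = (ascPochhammer ℂ n).eval (3 / 2 : ℂ) := fun n => by
    rw [← nsmul_eq_mul, Ring.factorial_nsmul_multichoose_eq_ascPochhammer,
      Polynomial.ascPochhammer_smeval_eq_eval]
  induction n with
  | zero => simp [threeHalvesCoeff]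
  | succ n ih =>
    have h1 := hasc (n + 1)
    rw [ascPochhammer_succ_eval, ← hasc n, ih, Nat.factorial_succ] at h1
    have : threeHalvesCoeff (n + 1) = threeHalvesCoeff n * ((3 / 2 + n) / (n + 1)) :=
      Finset.prod_range_succ _ _
    rw [this]
    have hf : (n.factorial : ℂ) ≠ 0 := by exact_mod_cast n.factorial_ne_zero
    have hn : (n : ℂ) + 1 ≠ 0 := by exact_mod_cast n.succ_ne_zero
    push_cast at h1 ⊢
    refine mul_left_cancel₀ (mul_ne_zero hn hf) ?_
    rw [h1]
    field_simp

/-- The principal square root of `1 - zᵈ`. -/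
noncomputable def sqrtOneSub (d : ℕ) (z : ℂ) : ℂ := (1 - z ^ d) ^ (1 / 2 : ℂ)

section SqrtOneSub

variable {d : ℕ} {z : ℂ}

lemma sqrtOneSub_sq (d : ℕ) (z : ℂ) : sqrtOneSub d z ^ 2 = 1 - z ^ d := by
  simp [sqrtOneSub, ← Complex.cpow_nat_mul]

lemma norm_pow_lt_one (hd : d ≠ 0) (hz : ‖z‖ < 1) : ‖z ^ d‖ < 1 := by
  rw [norm_pow]; exact pow_lt_one₀ (norm_nonneg _) hz hd

lemma one_sub_pow_re_pos (hd : d ≠ 0) (hz : ‖z‖ < 1) : 0 < (1 - z ^ d).re := by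
  have := (Complex.re_le_norm (z ^ d)).trans_lt (norm_pow_lt_one hd hz)
  simpa using this

lemma sqrtOneSub_ne_zero (hd : d ≠ 0) (hz : ‖z‖ < 1) : sqrtOneSub d z ≠ 0 := fun h => by
  have h1 := sqrtOneSub_sq d z
  have h2 := one_sub_pow_re_pos hd hz
  rw [h] at h1
  rw [← h1] at h2
  simp at h2

lemma norm_sqrtOneSub (d : ℕ) (z : ℂ) : ‖sqrtOneSub d z‖ = √‖1 - z ^ d‖ := by
  rw [← sqrtOneSub_sq, norm_pow, Real.sqrt_sq (norm_nonneg _)]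

lemma sqrtOneSub_re_nonneg (d : ℕ) (z : ℂ) : 0 ≤ (sqrtOneSub d z).re := by
  rw [sqrtOneSub]
  by_cases h : 1 - z ^ d = 0
  · simp [h]
  · rw [Complex.cpow_def_of_ne_zero h, Complex.exp_re]
    refine mul_nonneg (Real.exp_pos _).le (Real.cos_nonneg_of_mem_Icc ?_)
    have h1 := Complex.neg_pi_lt_arg (1 - z ^ d)
    have h2 := Complex.arg_le_pi (1 - z ^ d)
    have h3 : (Complex.log (1 - z ^ d) * (1 / 2)).im = (1 - z ^ d).arg / 2 := by
      rw [show (1 / 2 : ℂ) = ((1 / 2 : ℝ) : ℂ) by push_cast; rfl, Complex.im_mul_ofReal,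
        Complex.log_im]
      ring
    rw [h3]
    constructor <;> linarith

lemma hasSum_inv_sqrtOneSub_pow_three (hd : d ≠ 0) (hz : ‖z‖ < 1) :
    HasSum (fun j => (threeHalvesCoeff j : ℂ) * z ^ (d * j)) (sqrtOneSub d z ^ 3)⁻¹ := by
  have h := (Complex.one_div_one_sub_cpow_hasFPowerSeriesOnBall_zero (3 / 2)).hasSum (y := z ^ d) (by
    rw [← ENNReal.ofReal_one, Metric.eball_ofReal]
    simpa using norm_pow_lt_one hd hz)
  convert! h using 1
  · funext j
    simp [← Ring.multichoose_eq, multichoose_threeHalves, pow_mul, mul_comm]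
  · rw [zero_add, one_div, sqrtOneSub, ← Complex.cpow_nat_mul]
    norm_num

lemma differentiableOn_sqrtOneSub (hd : d ≠ 0) :
    DifferentiableOn ℂ (sqrtOneSub d) (Metric.ball 0 1) := by
  intro z hz
  have hz' : ‖z‖ < 1 := by simpa using hz
  have h : DifferentiableAt ℂ (fun z : ℂ => 1 - z ^ d) z := by fun_prop
  exact (h.cpow (differentiableAt_const _)
    (Or.inl (one_sub_pow_re_pos hd hz'))).differentiableWithinAt

/-- The coefficients of `z^(d-1) (1 - zᵈ)^(-3/2)`. -/
noncomputable def comparisonCoeff (d : ℕ) : ℕ → ℂ :=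
  Function.extend (fun j => d * j + (d - 1)) (fun j => (threeHalvesCoeff j : ℂ)) 0

lemma injective_mul_add (hd : d ≠ 0) : Function.Injective fun j => d * j + (d - 1) :=
  fun i j h => by simpa [hd] using h

lemma hasCoeffs_comparison (hd : d ≠ 0) :
    HasCoeffs (fun z => z ^ (d - 1) * (sqrtOneSub d z ^ 3)⁻¹) (comparisonCoeff d) := by
  filter_upwards [Metric.ball_mem_nhds (0 : ℂ) one_pos] with z hz
  have hz' : ‖z‖ < 1 := by simpa using hz
  have h := (hasSum_inv_sqrtOneSub_pow_three hd hz').mul_left (z ^ (d - 1))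
  rw [← (injective_mul_add hd).hasSum_iff]
  · convert! h using 2 with j
    simp only [Function.comp, comparisonCoeff, (injective_mul_add hd).extend_apply]
    ring
  · intro n hn
    rw [comparisonCoeff, Function.extend_apply' _ _ _ (by simpa using hn)]
    simp

lemma comparisonCoeff_apply (hd : d ≠ 0) (j : ℕ) :
    comparisonCoeff d (d * j + (d - 1)) = threeHalvesCoeff j :=
  (injective_mul_add hd).extend_apply _ _ j

lemma differentiableOn_comparison (hd : d ≠ 0) :
    DifferentiableOn ℂ (fun z => z ^ (d - 1) * (sqrtOneSub d z ^ 3)⁻¹) (Metric.ball 0 1) :=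
  DifferentiableOn.mul (by fun_prop) (((differentiableOn_sqrtOneSub hd).pow 3).inv fun z hz =>
    pow_ne_zero 3 (sqrtOneSub_ne_zero hd (by simpa using hz)))

end SqrtOneSub

/-- `q` is a critical offspring law with finite positive variance and span `d`, and `a` is the
sequence of coefficients of the associated tree generating function, that is, the solution of
`F = z Φ(F)`. -/
structure IsCriticalTreeSeries (q a : ℕ → ℝ) (d : ℕ) : Prop where
  q_nonneg : ∀ k, 0 ≤ q k
  q_summable : Summable q
  q_tsum : ∑' k, q k = 1
  dq_summable : Summable (dcoeff q)
  dq_tsum : ∑' k, dcoeff q k = 1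
  ddq_summable : Summable (dcoeff (dcoeff q))
  ddq_pos : 0 < ∑' k, dcoeff (dcoeff q) k
  a_nonneg : ∀ n, 0 ≤ a n
  a_summable : Summable a
  a_tsum_le : ∑' n, a n ≤ 1
  eqn : ∀ z : ℂ, ‖z‖ ≤ 1 → pgf a z = z * pgf q (pgf a z)
  d_ne_zero : d ≠ 0
  dvd_of_ne_zero : ∀ k, q k ≠ 0 → d ∣ k
  pow_eq_one : ∀ u : ℂ, (∀ k, q k ≠ 0 → u ^ k = 1) → u ^ d = 1
  modEq_of_ne_zero : ∀ n, a n ≠ 0 → n ≡ 1 [MOD d]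

/-- The generating function `z Φ'(F(z))`. -/
noncomputable def spineGen (q a : ℕ → ℝ) (z : ℂ) : ℂ := z * pgf (dcoeff q) (pgf a z)

namespace IsCriticalTreeSeries

variable {q a : ℕ → ℝ} {d : ℕ}

section Basic

variable (h : IsCriticalTreeSeries q a d) {u z : ℂ}
include h

lemma dq_nonneg : ∀ k, 0 ≤ dcoeff q k := dcoeff_nonneg h.q_nonneg

lemma ddq_nonneg : ∀ k, 0 ≤ dcoeff (dcoeff q) k := dcoeff_nonneg h.dq_nonneg

lemma norm_q_le (hu : ‖u‖ ≤ 1) : ‖pgf q u‖ ≤ 1 :=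
  (norm_pgf_le h.q_nonneg h.q_summable hu).trans h.q_tsum.le

lemma norm_dq_le (hu : ‖u‖ ≤ 1) : ‖pgf (dcoeff q) u‖ ≤ 1 :=
  (norm_pgf_le h.dq_nonneg h.dq_summable hu).trans h.dq_tsum.le

lemma norm_ddq_le (hu : ‖u‖ ≤ 1) :
    ‖pgf (dcoeff (dcoeff q)) u‖ ≤ ∑' k, dcoeff (dcoeff q) k :=
  norm_pgf_le h.ddq_nonneg h.ddq_summable hu

lemma norm_a_le (hz : ‖z‖ ≤ 1) : ‖pgf a z‖ ≤ 1 :=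
  (norm_pgf_le h.a_nonneg h.a_summable hz).trans h.a_tsum_le

lemma norm_a_lt (hz : ‖z‖ < 1) : ‖pgf a z‖ < 1 := by
  rw [h.eqn z hz.le, norm_mul]
  exact (mul_le_of_le_one_right (norm_nonneg _) (h.norm_q_le (h.norm_a_le hz.le))).trans_lt hz

lemma exists_q_pos : ∃ k, 0 < q (k + 2) := by
  by_contra! hcon
  have : ∀ k, dcoeff (dcoeff q) k = 0 := fun k => by
    have : q (k + 1 + 1) = 0 := le_antisymm (hcon k) (h.q_nonneg _)
    simp [dcoeff, this]
  have h1 := h.ddq_pos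
  simp [this] at h1

lemma q_zero_pos : 0 < q 0 := by
  have hk : HasSum (fun k => q (k + 1)) (1 - q 0) := by
    have := h.q_summable.tsum_eq_zero_add
    have h2 := ((summable_nat_add_iff 1).2 h.q_summable).hasSum
    rw [h.q_tsum] at this
    rwa [show 1 - q 0 = ∑' k, q (k + 1) by linarith]
  obtain ⟨k, hk0⟩ := h.exists_q_pos
  have hlt : 1 - q 0 < 1 := by
    have := hk.summable.tsum_lt_tsum (i := k + 1) (g := dcoeff q) (fun j => ?_) ?_ h.dq_summable
    · rwa [hk.tsum_eq, h.dq_tsum] at this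
    · simp only [dcoeff]; nlinarith [h.q_nonneg (j + 1), (Nat.cast_nonneg j : (0 : ℝ) ≤ j)]
    · simp only [dcoeff]; push_cast
      nlinarith [(Nat.cast_nonneg k : (0 : ℝ) ≤ k)]
  linarith

lemma pgf_q_ne_zero (hz : ‖z‖ ≤ 1) : pgf q (pgf a z) ≠ 0 := fun h0 => by
  have h1 := h.eqn z hz
  rw [h0, mul_zero] at h1
  rw [h1] at h0
  have h2 : pgf q 0 = q 0 := by
    rw [pgf, tsum_eq_single 0 (fun k hk => by simp [hk])]; simp
  rw [h2] at h0
  exact h.q_zero_pos.ne' (by exact_mod_cast h0)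

lemma pgf_a_one : pgf a 1 = 1 := by
  obtain ⟨R, -, -, hR0, hR⟩ :=
    exists_pgf_eq_add_mul_add_sq_mul h.q_nonneg h.q_summable h.dq_summable h.ddq_summable
  have h1 := h.eqn 1 (by simp)
  rw [one_mul, hR _ (h.norm_a_le (by simp)), h.q_tsum, h.dq_tsum] at h1
  have h2 := hR0 _ (tsum_nonneg h.a_nonneg) h.a_tsum_le h.ddq_pos
  rw [← pgf_one] at h2
  push_cast at h1
  have h3 : (pgf a 1 - 1) ^ 2 * R (pgf a 1) = 0 := by linear_combination -h1
  have h4 := pow_eq_zero_iff (two_ne_zero) |>.1 ((mul_eq_zero.1 h3).resolve_right h2)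
  exact sub_eq_zero.1 h4

lemma norm_dq_lt (hu : ‖u‖ < 1) : ‖pgf (dcoeff q) u‖ < 1 := by
  have hterm : ∀ k, dcoeff q k * ‖u‖ ^ k ≤ dcoeff q k := fun k =>
    mul_le_of_le_one_right (h.dq_nonneg k) (pow_le_one₀ (norm_nonneg _) hu.le)
  have hs : Summable fun k => dcoeff q k * ‖u‖ ^ k :=
    Summable.of_nonneg_of_le (fun k => mul_nonneg (h.dq_nonneg k) (by positivity)) hterm
      h.dq_summable
  have h1 : ‖pgf (dcoeff q) u‖ ≤ ∑' k, dcoeff q k * ‖u‖ ^ k :=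
    tsum_of_norm_bounded hs.hasSum fun k => by
      rw [norm_mul, norm_pow, Complex.norm_real, Real.norm_of_nonneg (h.dq_nonneg k)]
  obtain ⟨k, hk⟩ := h.exists_q_pos
  refine h1.trans_lt ?_
  rw [← h.dq_tsum]
  refine hs.tsum_lt_tsum (i := k + 1) hterm ?_ h.dq_summable
  have hpos : 0 < dcoeff q (k + 1) := mul_pos (by positivity) hk
  exact mul_lt_of_lt_one_right hpos (pow_lt_one₀ (norm_nonneg _) hu (by omega))

/-- On the closed unit disc, `|F| = 1` only at the `d`-th roots of unity. -/
lemma norm_a_lt_of_pow_ne (hz : ‖z‖ ≤ 1) (hzd : z ^ d ≠ 1) : ‖pgf a z‖ < 1 := by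
  refine lt_of_le_of_ne (h.norm_a_le hz) fun h1 => hzd ?_
  set u := pgf a z with hu
  have heq : u = z * pgf q u := h.eqn z hz
  have hq1 : ‖pgf q u‖ = 1 := by
    refine le_antisymm (h.norm_q_le h1.le) ?_
    calc (1 : ℝ) = ‖z‖ * ‖pgf q u‖ := by rw [← norm_mul, ← heq, h1]
      _ ≤ ‖pgf q u‖ := mul_le_of_le_one_left (norm_nonneg _) hz
  set c := pgf q u with hc
  have hcc : c * (starRingEnd ℂ) c = 1 := by
    rw [Complex.mul_conj, Complex.normSq_eq_norm_sq, hq1]; simp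
  have hterm : ∀ k, ‖u ^ k * (starRingEnd ℂ) c‖ = 1 := fun k => by
    rw [norm_mul, norm_pow, h1, RCLike.norm_conj, hq1]; simp
  have hsum : HasSum (fun k => q k * (1 - (u ^ k * (starRingEnd ℂ) c).re)) 0 := by
    have e1 := Complex.hasSum_re ((hasSum_pgf h.q_nonneg h.q_summable h1.le).mul_right
      ((starRingEnd ℂ) c))
    rw [← hc, hcc] at e1
    have e2 := h.q_summable.hasSum.sub e1
    rw [h.q_tsum, Complex.one_re, sub_self] at e2
    convert! e2 using 2 with k
    rw [mul_assoc, Complex.re_ofReal_mul]; ring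
  have hnn : ∀ k, 0 ≤ q k * (1 - (u ^ k * (starRingEnd ℂ) c).re) := fun k =>
    mul_nonneg (h.q_nonneg k) (by linarith [Complex.re_le_norm (u ^ k * (starRingEnd ℂ) c), hterm k])
  have hzero := (hasSum_zero_iff_of_nonneg hnn).1 hsum
  have hpow : ∀ k, q k ≠ 0 → u ^ k = c := fun k hk => by
    have e1 := congrFun hzero k
    simp only [Pi.zero_apply, mul_eq_zero, hk, false_or] at e1
    have e2 : u ^ k * (starRingEnd ℂ) c = 1 := by
      have e3 := hterm k
      have e4 : (u ^ k * (starRingEnd ℂ) c).re = 1 := by linarith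
      have e5 : (u ^ k * (starRingEnd ℂ) c).im = 0 := by
        have := Complex.sq_norm (u ^ k * (starRingEnd ℂ) c)
        rw [e3, Complex.normSq_apply, e4] at this
        nlinarith
      exact Complex.ext (by simpa using e4) (by simpa using e5)
    calc u ^ k = u ^ k * (c * (starRingEnd ℂ) c) := by rw [hcc, mul_one]
      _ = c * (u ^ k * (starRingEnd ℂ) c) := by ring
      _ = c := by rw [e2, mul_one]
  have hc1 : c = 1 := by rw [← hpow 0 h.q_zero_pos.ne', pow_zero]
  rw [hc1, mul_one] at heq
  rw [← heq]
  exact h.pow_eq_one u fun k hk => (hpow k hk).trans hc1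

lemma norm_spineGen_lt (hz : ‖z‖ ≤ 1) (hF : ‖pgf a z‖ < 1) : ‖spineGen q a z‖ < 1 := by
  rw [spineGen, norm_mul]
  exact (mul_le_of_le_one_left (norm_nonneg _) hz).trans_lt (h.norm_dq_lt hF)

lemma one_sub_spineGen_ne_zero (hz : ‖z‖ < 1) : 1 - spineGen q a z ≠ 0 := fun h0 => by
  have h1 := h.norm_spineGen_lt hz.le (h.norm_a_lt hz)
  rw [← sub_eq_zero.1 h0, norm_one] at h1
  exact lt_irrefl _ h1

lemma continuousOn_a : ContinuousOn (pgf a) (Metric.closedBall 0 1) :=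
  continuousOn_pgf h.a_nonneg h.a_summable

lemma mapsTo_a : MapsTo (pgf a) (Metric.closedBall 0 1) (Metric.closedBall 0 1) :=
  fun z hz => by simpa using h.norm_a_le (z := z) (by simpa using hz)

lemma continuousOn_spineGen : ContinuousOn (spineGen q a) (Metric.closedBall 0 1) :=
  continuousOn_id.mul ((continuousOn_pgf h.dq_nonneg h.dq_summable).comp h.continuousOn_a h.mapsTo_a)

lemma hasDerivAt_a (hz : ‖z‖ < 1) :
    HasDerivAt (pgf a) (pgf q (pgf a z) / (1 - spineGen q a z)) z := by
  have h1 := hasDerivAt_pgf h.a_nonneg h.a_summable hz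
  have h2 := hasDerivAt_pgf h.q_nonneg h.q_summable (h.norm_a_lt hz)
  have h3 := (hasDerivAt_id' z).mul (h2.comp z h1)
  have h4 : pgf a =ᶠ[𝓝 z] fun z => z * (pgf q ∘ pgf a) z := by
    filter_upwards [Metric.isOpen_ball.mem_nhds (show z ∈ Metric.ball (0 : ℂ) 1 by simpa using hz)]
      with w hw
    exact h.eqn w (by simpa using (mem_ball_zero_iff.1 hw).le)
  have h5 := h1.unique (h3.congr_of_eventuallyEq h4)
  have h6 : pgf (dcoeff a) z = pgf q (pgf a z) / (1 - spineGen q a z) := by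
    rw [eq_div_iff (h.one_sub_spineGen_ne_zero hz), spineGen]
    simp only [Function.comp] at h5
    linear_combination h5
  rwa [h6] at h1

lemma hasDerivAt_spineGen (hz : ‖z‖ < 1) :
    HasDerivAt (spineGen q a) (pgf (dcoeff q) (pgf a z) + z * (pgf (dcoeff (dcoeff q)) (pgf a z) *
      (pgf q (pgf a z) / (1 - spineGen q a z)))) z := by
  have h2 := hasDerivAt_pgf h.dq_nonneg h.dq_summable (h.norm_a_lt hz)
  have h3 := (hasDerivAt_id' z).mul (h2.comp z (h.hasDerivAt_a hz))
  rw [one_mul] at h3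
  exact h3

lemma hasDerivAt_deriv_a (hz : ‖z‖ < 1) :
    HasDerivAt (deriv (pgf a))
      (2 * pgf (dcoeff q) (pgf a z) * pgf q (pgf a z) / (1 - spineGen q a z) ^ 2 +
        z * pgf (dcoeff (dcoeff q)) (pgf a z) * pgf q (pgf a z) ^ 2 / (1 - spineGen q a z) ^ 3)
      z := by
  have h0 := h.one_sub_spineGen_ne_zero hz
  have h2 := hasDerivAt_pgf h.q_nonneg h.q_summable (h.norm_a_lt hz)
  have h3 := (h2.comp z (h.hasDerivAt_a hz)).div ((h.hasDerivAt_spineGen hz).const_sub 1) h0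
  have h4 : deriv (pgf a) =ᶠ[𝓝 z] fun z => (pgf q ∘ pgf a) z / (1 - spineGen q a z) := by
    filter_upwards [Metric.isOpen_ball.mem_nhds (show z ∈ Metric.ball (0 : ℂ) 1 by simpa using hz)]
      with w hw
    exact (h.hasDerivAt_a (by simpa using hw)).deriv
  convert! h3.congr_of_eventuallyEq h4 using 1
  simp only [Function.comp]
  field_simp
  ring

end Basic

end IsCriticalTreeSeries

lemma norm_le_four_mul_one_sub_norm {v : ℂ} (h1 : ‖v‖ / 2 ≤ v.re) (h2 : ‖v‖ ≤ 1 / 2) :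
    ‖v‖ ≤ 4 * (1 - ‖1 - v‖) := by
  have e1 : ‖1 - v‖ ^ 2 = 1 - 2 * v.re + ‖v‖ ^ 2 := by
    rw [Complex.sq_norm, Complex.sq_norm, Complex.normSq_apply, Complex.normSq_apply]
    simp; ring
  have h0 := norm_nonneg v
  have e2 : ‖1 - v‖ ≤ 1 - ‖v‖ / 4 := by
    refine abs_le_of_sq_le_sq' ?_ (by linarith) |>.2
    rw [e1]; nlinarith
  linarith

/-- If `Re w > 0`, `w = v² A` with `A` close to a positive real, and `Re v > 0`, then `v` lies in a
sector strictly inside the right half-plane. -/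
lemma two_thirds_norm_le_re {v A : ℂ} {c : ℝ} (hc : 0 < c) (hA : ‖A - c‖ ≤ c / 9)
    (hv : 0 < v.re) (hw : 0 < (v ^ 2 * A).re) : 2 / 3 * ‖v‖ ≤ v.re := by
  have e1 : (v ^ 2 * A).re = c * (2 * v.re ^ 2 - ‖v‖ ^ 2) + (v ^ 2 * (A - c)).re := by
    rw [Complex.sq_norm, Complex.normSq_apply]
    simp [pow_two]; ring
  have e2 : (v ^ 2 * (A - c)).re ≤ ‖v‖ ^ 2 * (c / 9) := by
    refine (Complex.re_le_norm _).trans ?_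
    rw [norm_mul, norm_pow]; gcongr
  have e3 : 0 < c * (2 * v.re ^ 2 - ‖v‖ ^ 2 + ‖v‖ ^ 2 / 9) := by nlinarith
  have e4 := pos_of_mul_pos_right e3 hc.le
  exact abs_le_of_sq_le_sq' (by nlinarith) hv.le |>.2

/-- Compactness: a family of bounds holding near `1`, invariant under the `d`-th roots of unity,
and holding locally elsewhere, holds on the whole disc. -/
lemma exists_forall_of_local {d : ℕ} (hd : d ≠ 0) {Q : ℝ → ℂ → Prop}
    (hmono : ∀ {C C' z}, C ≤ C' → ‖z‖ < 1 → Q C z → Q C' z)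
    (hrot : ∀ {C z ω}, ω ^ d = 1 → ‖z‖ < 1 → Q C z → Q C (ω * z))
    (hone : ∃ C, ∀ᶠ z in 𝓝[Metric.ball 0 1] 1, Q C z)
    (hne : ∀ z₀ : ℂ, ‖z₀‖ ≤ 1 → z₀ ^ d ≠ 1 → ∃ C, ∀ᶠ z in 𝓝[Metric.ball 0 1] z₀, Q C z) :
    ∃ C, 0 ≤ C ∧ ∀ z : ℂ, ‖z‖ < 1 → Q C z := by
  have key : ∃ C, ∀ z ∈ Metric.closedBall (0 : ℂ) 1, ‖z‖ < 1 → Q C z := by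
    refine (isCompact_closedBall (0 : ℂ) 1).induction_on
      (p := fun s => ∃ C, ∀ z ∈ s, ‖z‖ < 1 → Q C z) ⟨0, by simp⟩ ?_ ?_ ?_
    · rintro s t hst ⟨C, hC⟩
      exact ⟨C, fun z hz => hC z (hst hz)⟩
    · rintro s t ⟨C, hC⟩ ⟨C', hC'⟩
      refine ⟨max C C', ?_⟩
      rintro z (hz | hz) h1
      · exact hmono (le_max_left _ _) h1 (hC z hz h1)
      · exact hmono (le_max_right _ _) h1 (hC' z hz h1)
    · intro z₀ hz₀
      have : ∃ C, ∀ᶠ z in 𝓝[Metric.ball 0 1] z₀, Q C z := by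
        by_cases h : z₀ ^ d = 1
        · obtain ⟨C, hC⟩ := hone
          refine ⟨C, ?_⟩
          have hn : ‖z₀‖ = 1 := Complex.norm_eq_one_of_pow_eq_one h hd
          have hz0 : z₀ ≠ 0 := norm_ne_zero_iff.1 (by rw [hn]; norm_num)
          have ht : Tendsto (fun z => z₀⁻¹ * z) (𝓝[Metric.ball 0 1] z₀)
              (𝓝[Metric.ball 0 1] 1) := by
            refine tendsto_nhdsWithin_iff.2 ⟨?_, ?_⟩
            · have h2 : Tendsto (fun z => z₀⁻¹ * z) (𝓝 z₀) (𝓝 (z₀⁻¹ * z₀)) :=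
                (continuous_const_mul _).tendsto _
              rw [inv_mul_cancel₀ hz0] at h2
              exact h2.mono_left nhdsWithin_le_nhds
            · filter_upwards [self_mem_nhdsWithin] with z hz
              simpa [hn] using hz
          filter_upwards [ht.eventually hC, self_mem_nhdsWithin] with z hz hzb
          have h3 := hrot h (by simpa [hn] using hzb) hz
          rwa [mul_inv_cancel_left₀ hz0] at h3
        · exact hne z₀ (by simpa using hz₀) h
      obtain ⟨C, hC⟩ := this
      obtain ⟨u, hu, hz0u, hu2⟩ := mem_nhdsWithin.1 hC
      exact ⟨u, mem_nhdsWithin_of_mem_nhds (hu.mem_nhds hz0u), C,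
        fun z hz h1 => hu2 ⟨hz, by simpa using h1⟩⟩
  obtain ⟨C, hC⟩ := key
  exact ⟨max C 0, le_max_right _ _,
    fun z hz => hmono (le_max_left _ _) hz (hC z (by simpa using hz.le) hz)⟩

lemma pgf_mul_of_pow_eq {c : ℕ → ℝ} {ω η : ℂ} (h : ∀ k, c k ≠ 0 → ω ^ k = η) (u : ℂ) :
    pgf c (ω * u) = η * pgf c u := by
  rw [pgf, pgf, ← tsum_mul_left]
  refine tsum_congr fun k => ?_
  by_cases hk : c k = 0
  · simp [hk]
  · rw [mul_pow, h k hk]; ring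

lemma norm_one_sub_pow_le {d : ℕ} {z : ℂ} (hz : ‖z‖ ≤ 1) : ‖1 - z ^ d‖ ≤ d * ‖1 - z‖ := by
  rw [← mul_neg_geom_sum, norm_mul, mul_comm]
  gcongr
  refine (norm_sum_le _ _).trans ((Finset.sum_le_card_nsmul _ _ 1 fun i _ => ?_).trans ?_)
  · rw [norm_pow]; exact pow_le_one₀ (norm_nonneg _) hz
  · simp

lemma sqrt_norm_one_sub_pow_le {d : ℕ} {z : ℂ} (hz : ‖z‖ ≤ 1) : √‖1 - z ^ d‖ ≤ 2 := by
  rw [Real.sqrt_le_iff]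
  refine ⟨by norm_num, (norm_sub_le _ _).trans ?_⟩
  rw [norm_one, norm_pow]
  linarith [pow_le_one₀ (n := d) (norm_nonneg z) hz]

/-- The second derivative of the tree generating function, expressed through `F` itself. -/
noncomputable def treeGenDerivTwo (q a : ℕ → ℝ) (z : ℂ) : ℂ :=
  2 * pgf (dcoeff q) (pgf a z) * pgf q (pgf a z) / (1 - spineGen q a z) ^ 2 +
    z * pgf (dcoeff (dcoeff q)) (pgf a z) * pgf q (pgf a z) ^ 2 / (1 - spineGen q a z) ^ 3

namespace IsCriticalTreeSeries

variable {q a : ℕ → ℝ} {d : ℕ}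

section Rotation

variable (h : IsCriticalTreeSeries q a d) {ω : ℂ} (hω : ω ^ d = 1) (z : ℂ)
include h hω

lemma root_ne_zero : ω ≠ 0 := fun h0 => by
  rw [h0, zero_pow h.d_ne_zero] at hω
  exact zero_ne_one hω

lemma pgf_a_mul : pgf a (ω * z) = ω * pgf a z := by
  refine pgf_mul_of_pow_eq (fun n hn => ?_) z
  rw [pow_eq_pow_mod n hω, h.modEq_of_ne_zero n hn, ← pow_eq_pow_mod 1 hω, pow_one]

lemma pow_eq_one_of_ne_zero {k : ℕ} (hk : q k ≠ 0) : ω ^ k = 1 := by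
  obtain ⟨j, rfl⟩ := h.dvd_of_ne_zero k hk
  rw [pow_mul, hω, one_pow]

lemma pgf_q_mul (u : ℂ) : pgf q (ω * u) = pgf q u := by
  rw [pgf_mul_of_pow_eq (fun k hk => h.pow_eq_one_of_ne_zero hω hk), one_mul]

lemma pgf_dq_mul (u : ℂ) : pgf (dcoeff q) (ω * u) = ω⁻¹ * pgf (dcoeff q) u := by
  refine pgf_mul_of_pow_eq (fun k hk => ?_) u
  rw [dcoeff, mul_ne_zero_iff] at hk
  refine eq_inv_of_mul_eq_one_left ?_
  rw [← pow_succ]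
  exact h.pow_eq_one_of_ne_zero hω hk.2

lemma pgf_ddq_mul (u : ℂ) :
    pgf (dcoeff (dcoeff q)) (ω * u) = (ω ^ 2)⁻¹ * pgf (dcoeff (dcoeff q)) u := by
  refine pgf_mul_of_pow_eq (fun k hk => ?_) u
  rw [dcoeff, dcoeff, mul_ne_zero_iff, mul_ne_zero_iff] at hk
  refine eq_inv_of_mul_eq_one_left ?_
  rw [← pow_add]
  exact h.pow_eq_one_of_ne_zero hω hk.2.2

lemma spineGen_mul : spineGen q a (ω * z) = spineGen q a z := by
  have := h.root_ne_zero hω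
  rw [spineGen, spineGen, h.pgf_a_mul hω, h.pgf_dq_mul hω]
  field_simp

lemma treeGenDerivTwo_mul : treeGenDerivTwo q a (ω * z) = ω⁻¹ * treeGenDerivTwo q a z := by
  have := h.root_ne_zero hω
  rw [treeGenDerivTwo, treeGenDerivTwo, h.pgf_a_mul hω, h.pgf_q_mul hω, h.pgf_dq_mul hω,
    h.pgf_ddq_mul hω, h.spineGen_mul hω]
  field_simp

end Rotation

lemma norm_root_mul {ω : ℂ} (h : IsCriticalTreeSeries q a d) (hω : ω ^ d = 1) (z : ℂ) :
    ‖ω * z‖ = ‖z‖ := by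
  rw [norm_mul, Complex.norm_eq_one_of_pow_eq_one hω h.d_ne_zero, one_mul]

end IsCriticalTreeSeries

namespace IsCriticalTreeSeries

variable {q a : ℕ → ℝ} {d : ℕ}

section Local

variable (h : IsCriticalTreeSeries q a d)
include h

lemma tendsto_comp_a {R : ℂ → ℂ} (hR : ContinuousOn R (Metric.closedBall 0 1)) :
    Tendsto (fun z => R (pgf a z)) (𝓝[Metric.ball 0 1] 1) (𝓝 (R 1)) := by
  have h1 : ContinuousWithinAt (fun z => R (pgf a z)) (Metric.closedBall 0 1) 1 :=
    (hR.comp h.continuousOn_a h.mapsTo_a) 1 (by simp)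
  have h2 := h1.tendsto
  rw [h.pgf_a_one] at h2
  exact h2.mono_left (nhdsWithin_mono _ Metric.ball_subset_closedBall)

lemma tendsto_a : Tendsto (pgf a) (𝓝[Metric.ball 0 1] 1) (𝓝 1) := h.tendsto_comp_a continuousOn_id

/-- The square-root singularity of `F` at `1`. -/
lemma exists_local_expansion : ∃ A B : ℂ → ℂ,
    Tendsto A (𝓝[Metric.ball 0 1] 1) (𝓝 (((∑' k, dcoeff (dcoeff q) k) / 2 : ℝ) : ℂ)) ∧
    Tendsto B (𝓝[Metric.ball 0 1] 1) (𝓝 ((∑' k, dcoeff (dcoeff q) k : ℝ) : ℂ)) ∧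
    ∀ z : ℂ, ‖z‖ < 1 → 1 - z = (1 - pgf a z) ^ 2 * A z ∧
      1 - spineGen q a z = (1 - pgf a z) * B z := by
  obtain ⟨R, hRc, hR1, -, hR⟩ :=
    exists_pgf_eq_add_mul_add_sq_mul h.q_nonneg h.q_summable h.dq_summable h.ddq_summable
  obtain ⟨S, hSc, hS1, hS⟩ := exists_pgf_eq_add_mul h.dq_nonneg h.dq_summable h.ddq_summable
  have hq1 : pgf q 1 = 1 := by rw [pgf_one, h.q_tsum]; simp
  have tq := h.tendsto_comp_a (continuousOn_pgf h.q_nonneg h.q_summable)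
  rw [hq1] at tq
  have tR := h.tendsto_comp_a hRc
  have tS := h.tendsto_comp_a hSc
  refine ⟨fun z => R (pgf a z) / pgf q (pgf a z), fun z =>
    ((1 - pgf a z) * R (pgf a z) + pgf a z * S (pgf a z)) / pgf q (pgf a z), ?_, ?_, ?_⟩
  · have := tR.div tq one_ne_zero
    rw [hR1, div_one] at this
    exact_mod_cast this
  · have := (((h.tendsto_a.const_sub 1).mul tR).add (h.tendsto_a.mul tS)).div tq one_ne_zero
    rw [hS1, sub_self, zero_mul, zero_add, one_mul, div_one] at this
    exact this
  · intro z hz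
    have h0 := h.pgf_q_ne_zero hz.le
    have e1 := h.eqn z hz.le
    have e2 := hR (pgf a z) (h.norm_a_le hz.le)
    have e3 := hS (pgf a z) (h.norm_a_le hz.le)
    rw [h.q_tsum, h.dq_tsum] at e2
    rw [h.dq_tsum] at e3
    push_cast at e2 e3
    constructor
    · field_simp
      linear_combination e2 + e1
    · rw [spineGen, ← mul_div_assoc, eq_div_iff h0]
      rw [e3]
      linear_combination e2 - (1 + (pgf a z - 1) * S (pgf a z)) * (- e1)

/-- Bounds near the singularity `1`: both `1 - F` and `1 - W` are of order `√|1 - z|` and lie in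
a sector inside the right half-plane. -/
lemma eventually_bounds : ∃ C, ∀ᶠ z in 𝓝[Metric.ball 0 1] 1,
    √‖1 - z ^ d‖ ≤ C * (1 - ‖pgf a z‖) ∧ √‖1 - z ^ d‖ ≤ C * ‖1 - spineGen q a z‖ ∧
    ‖1 - spineGen q a z‖ ≤ 4 * (1 - ‖spineGen q a z‖) ∧
    ‖1 - spineGen q a z‖ / 2 ≤ (1 - spineGen q a z).re := by
  obtain ⟨A, B, hA, hB, hAB⟩ := h.exists_local_expansion
  set σ := ∑' k, dcoeff (dcoeff q) k with hσ
  have hσ0 : 0 < σ := h.ddq_pos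
  refine ⟨max (4 * √(d * σ)) (√(d * σ) * (2 / σ)), ?_⟩
  have hv : Tendsto (fun z => ‖1 - pgf a z‖) (𝓝[Metric.ball 0 1] 1) (𝓝 0) := by
    simpa using (h.tendsto_a.const_sub 1).norm
  have tA := (tendsto_iff_norm_sub_tendsto_zero.1 hA).eventually_le_const
    (show 0 < σ / 2 / 9 by positivity)
  have tB := (tendsto_iff_norm_sub_tendsto_zero.1 hB).eventually_le_const
    (show 0 < σ / 10 by positivity)
  have tv := hv.eventually_le_const (show 0 < min (1 / 2) (1 / (4 * σ)) by positivity)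
  filter_upwards [self_mem_nhdsWithin, tA, tB, tv] with z hzb hzA hzB hzv
  have hz : ‖z‖ < 1 := by simpa using hzb
  obtain ⟨eA, eB⟩ := hAB z hz
  set v := 1 - pgf a z with hv
  have hvre : 0 < v.re := by
    have := (Complex.re_le_norm (pgf a z)).trans_lt (h.norm_a_lt hz)
    rw [hv, Complex.sub_re, Complex.one_re]; linarith
  have hzre : 0 < (v ^ 2 * A z).re := by
    rw [← eA, Complex.sub_re, Complex.one_re]
    linarith [(Complex.re_le_norm z).trans_lt hz]
  have hv23 := two_thirds_norm_le_re (by positivity) hzA hvre hzre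
  have hvn := norm_nonneg v
  have hF : ‖v‖ ≤ 4 * (1 - ‖pgf a z‖) := by
    have := norm_le_four_mul_one_sub_norm (v := v) (by linarith)
      (hzv.trans (min_le_left _ _))
    rwa [hv, sub_sub_cancel, ← hv] at this
  have hBre : σ * v.re - ‖v‖ * (σ / 10) ≤ (v * B z).re := by
    have e1 : (v * B z).re = σ * v.re + (v * (B z - σ)).re := by simp; ring
    have e2 := (abs_le.1 ((Complex.abs_re_le_norm (v * (B z - σ))))).1
    rw [norm_mul] at e2
    have e3 : ‖v‖ * ‖B z - σ‖ ≤ ‖v‖ * (σ / 10) := by gcongr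
    linarith
  have hBup : ‖v * B z‖ ≤ ‖v‖ * (σ * (11 / 10)) := by
    rw [norm_mul]
    gcongr
    have := norm_add_le (B z - σ) (σ : ℂ)
    rw [sub_add_cancel, Complex.norm_real, Real.norm_of_nonneg hσ0.le] at this
    linarith
  have hBlow : σ / 2 * ‖v‖ ≤ ‖v * B z‖ := by
    have := hBre.trans (Complex.re_le_norm _)
    nlinarith
  have hWre : ‖v * B z‖ / 2 ≤ (v * B z).re := by nlinarith
  have hAn : ‖A z‖ ≤ σ := by
    have := norm_add_le (A z - (σ / 2 : ℝ)) ((σ / 2 : ℝ) : ℂ)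
    rw [sub_add_cancel, Complex.norm_real, Real.norm_of_nonneg (by positivity)] at this
    linarith
  have hs : √‖1 - z ^ d‖ ≤ √(d * σ) * ‖v‖ := by
    rw [← Real.sqrt_sq hvn, ← Real.sqrt_mul (by positivity)]
    refine Real.sqrt_le_sqrt ((norm_one_sub_pow_le hz.le).trans ?_)
    rw [eA, norm_mul, norm_pow, mul_assoc]
    rw [mul_comm σ]
    gcongr
  rw [eB]
  refine ⟨?_, ?_, ?_, hWre⟩
  · calc _ ≤ √(d * σ) * ‖v‖ := hs
      _ ≤ √(d * σ) * (4 * (1 - ‖pgf a z‖)) := by gcongr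
      _ = 4 * √(d * σ) * (1 - ‖pgf a z‖) := by ring
      _ ≤ _ := by
        gcongr
        · linarith
        · exact le_max_left _ _
  · calc _ ≤ √(d * σ) * ‖v‖ := hs
      _ ≤ √(d * σ) * (2 / σ * ‖v * B z‖) := by
        gcongr
        rw [div_mul_eq_mul_div, le_div_iff₀ hσ0]; linarith
      _ = √(d * σ) * (2 / σ) * ‖v * B z‖ := by ring
      _ ≤ _ := by gcongr; exact le_max_right _ _
  · have h4 : ‖v * B z‖ ≤ 1 / 2 := by
      refine hBup.trans ?_
      have := hzv.trans (min_le_right _ _)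
      rw [le_div_iff₀ (by positivity)] at this
      nlinarith
    have := norm_le_four_mul_one_sub_norm hWre h4
    rwa [← eB, sub_sub_cancel, eB] at this

lemma tendsto_one_sub_spineGen_div : ∃ c : ℝ, 0 < c ∧
    Tendsto (fun z => (1 - spineGen q a z) / sqrtOneSub d z) (𝓝[Metric.ball 0 1] 1)
      (𝓝 (c : ℂ)) := by
  obtain ⟨A, B, hA, hB, hAB⟩ := h.exists_local_expansion
  set σ := ∑' k, dcoeff (dcoeff q) k with hσ
  have hσ0 : 0 < σ := h.ddq_pos
  have hd0 : (0 : ℝ) < d := by exact_mod_cast Nat.pos_of_ne_zero h.d_ne_zero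
  obtain ⟨C, hC⟩ := h.eventually_bounds
  set c := √(2 * σ / d) with hc
  have hc0 : 0 < c := by positivity
  have hcsq : c ^ 2 = 2 * σ / d := Real.sq_sqrt (by positivity)
  set ρ : ℂ → ℂ := fun z => (1 - spineGen q a z) / sqrtOneSub d z with hρ
  have hsq : Tendsto (fun z => ρ z ^ 2) (𝓝[Metric.ball 0 1] 1) (𝓝 ((c ^ 2 : ℝ) : ℂ)) := by
    have tg : Tendsto (fun z : ℂ => ∑ i ∈ Finset.range d, z ^ i) (𝓝[Metric.ball 0 1] 1)
        (𝓝 (d : ℂ)) := by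
      have : Continuous fun z : ℂ => ∑ i ∈ Finset.range d, z ^ i := by fun_prop
      simpa using (this.tendsto 1).mono_left nhdsWithin_le_nhds
    have t1 := (hB.pow 2).div (hA.mul tg) (mul_ne_zero (by exact_mod_cast (half_pos hσ0).ne')
      (by exact_mod_cast h.d_ne_zero))
    have e : ((c ^ 2 : ℝ) : ℂ) = (σ : ℂ) ^ 2 / (((σ / 2 : ℝ) : ℂ) * d) := by
      rw [hcsq]; push_cast; have : (σ : ℂ) ≠ 0 := by exact_mod_cast hσ0.ne'
      have : (d : ℂ) ≠ 0 := by exact_mod_cast h.d_ne_zero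
      field_simp
    rw [e]
    refine t1.congr' ?_
    filter_upwards [self_mem_nhdsWithin] with z hzb
    have hz : ‖z‖ < 1 := by simpa using hzb
    obtain ⟨eA, eB⟩ := hAB z hz
    have hne : (1 - z ^ d) ≠ 0 := by
      rw [← sqrtOneSub_sq]; exact pow_ne_zero _ (sqrtOneSub_ne_zero h.d_ne_zero hz)
    simp only [hρ, div_pow, sqrtOneSub_sq, Pi.div_apply]
    rw [← mul_neg_geom_sum, eA] at hne ⊢
    simp only [mul_ne_zero_iff] at hne
    rw [eB]
    have hv : 1 - pgf a z ≠ 0 := fun h0 => hne.1.1 (by rw [h0]; simp)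
    field_simp [hv, hne.1.2, hne.2]
  have hsq0 : Tendsto (fun z => ‖ρ z ^ 2 - (c ^ 2 : ℝ)‖) (𝓝[Metric.ball 0 1] 1) (𝓝 0) :=
    tendsto_iff_norm_sub_tendsto_zero.1 hsq
  refine ⟨c, hc0, tendsto_iff_norm_sub_tendsto_zero.2 ?_⟩
  have hlim := hsq0.const_mul (4 / c)
  rw [mul_zero] at hlim
  refine squeeze_zero' (Eventually.of_forall fun z => norm_nonneg _) ?_ hlim
  filter_upwards [self_mem_nhdsWithin, hC,
    hsq0.eventually_le_const (show 0 < 3 / 4 * c ^ 2 by positivity)] with z hzb hzC hzs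
  have hz : ‖z‖ < 1 := by simpa using hzb
  have hS := norm_pos_iff.2 (sqrtOneSub_ne_zero h.d_ne_zero hz)
  have hW : 1 - spineGen q a z = ρ z * sqrtOneSub d z :=
    (div_mul_cancel₀ _ (sqrtOneSub_ne_zero h.d_ne_zero hz)).symm
  have hρn : c / 2 ≤ ‖ρ z‖ := by
    have e1 := norm_sub_norm_le ((c ^ 2 : ℝ) : ℂ) (((c ^ 2 : ℝ) : ℂ) - ρ z ^ 2)
    rw [sub_sub_cancel, norm_sub_rev _ (ρ z ^ 2), Complex.norm_real, Real.norm_of_nonneg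
      (by positivity), norm_pow] at e1
    exact abs_le_of_sq_le_sq' (by nlinarith) (norm_nonneg _) |>.2
  have hsum : ‖ρ z‖ / 2 ≤ ‖ρ z + c‖ := by
    have e1 := hzC.2.2.2
    rw [hW, norm_mul] at e1
    have e2 : (ρ z * sqrtOneSub d z).re
        = ((ρ z + c) * sqrtOneSub d z).re - c * (sqrtOneSub d z).re := by simp; ring
    have e3 := Complex.re_le_norm ((ρ z + c) * sqrtOneSub d z)
    rw [norm_mul] at e3
    have e4 := mul_nonneg hc0.le (sqrtOneSub_re_nonneg d z)
    nlinarith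
  have hprod : ‖ρ z - c‖ * ‖ρ z + c‖ = ‖ρ z ^ 2 - (c ^ 2 : ℝ)‖ := by
    rw [← norm_mul]; congr 1; push_cast; ring
  rw [div_mul_eq_mul_div, le_div_iff₀ hc0, ← hprod]
  have := norm_nonneg (ρ z - c)
  nlinarith

lemma tendsto_treeGenDerivTwo : ∃ κ : ℝ, 0 < κ ∧
    Tendsto (fun z => treeGenDerivTwo q a z * sqrtOneSub d z ^ 3) (𝓝[Metric.ball 0 1] 1)
      (𝓝 (κ : ℂ)) := by
  obtain ⟨c, hc0, hc⟩ := h.tendsto_one_sub_spineGen_div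
  have hc0' : (c : ℂ) ≠ 0 := by exact_mod_cast hc0.ne'
  set σ := ∑' k, dcoeff (dcoeff q) k with hσ
  refine ⟨σ / c ^ 3, div_pos h.ddq_pos (by positivity), ?_⟩
  have t0 := h.tendsto_comp_a (continuousOn_pgf h.q_nonneg h.q_summable)
  have t1 := h.tendsto_comp_a (continuousOn_pgf h.dq_nonneg h.dq_summable)
  have t2 := h.tendsto_comp_a (continuousOn_pgf h.ddq_nonneg h.ddq_summable)
  rw [pgf_one, h.q_tsum, Complex.ofReal_one] at t0
  rw [pgf_one, h.dq_tsum, Complex.ofReal_one] at t1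
  rw [pgf_one, ← hσ] at t2
  have tS : Tendsto (sqrtOneSub d) (𝓝[Metric.ball 0 1] 1) (𝓝 0) := by
    rw [tendsto_zero_iff_norm_tendsto_zero]
    simp only [norm_sqrtOneSub]
    have : Continuous fun z : ℂ => √‖1 - z ^ d‖ := by fun_prop
    simpa using (this.tendsto 1).mono_left nhdsWithin_le_nhds
  have tz : Tendsto (fun z : ℂ => z) (𝓝[Metric.ball 0 1] 1) (𝓝 1) :=
    tendsto_id.mono_left nhdsWithin_le_nhds
  have key := ((((t1.mul t0).const_mul 2).mul tS).div (hc.pow 2) (pow_ne_zero 2 hc0')).add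
    (((tz.mul t2).mul (t0.pow 2)).div (hc.pow 3) (pow_ne_zero 3 hc0'))
  have e : ((σ / c ^ 3 : ℝ) : ℂ) = 2 * (1 * 1) * 0 / (c : ℂ) ^ 2 + 1 * σ * 1 ^ 2 / (c : ℂ) ^ 3 := by
    push_cast; ring
  rw [e]
  refine key.congr' ?_
  filter_upwards [self_mem_nhdsWithin] with z hzb
  have hz : ‖z‖ < 1 := by simpa using hzb
  have hS := sqrtOneSub_ne_zero h.d_ne_zero hz
  have hW := h.one_sub_spineGen_ne_zero hz
  simp only [treeGenDerivTwo, Pi.div_apply]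
  field_simp

end Local

end IsCriticalTreeSeries

namespace IsCriticalTreeSeries

variable {q a : ℕ → ℝ} {d : ℕ}

section Global

variable (h : IsCriticalTreeSeries q a d)
include h

lemma exists_global_bounds : ∃ C, 0 ≤ C ∧ ∀ z : ℂ, ‖z‖ < 1 →
    √‖1 - z ^ d‖ ≤ C * (1 - ‖pgf a z‖) ∧ √‖1 - z ^ d‖ ≤ C * ‖1 - spineGen q a z‖ ∧
    ‖1 - spineGen q a z‖ ≤ C * (1 - ‖spineGen q a z‖) := by
  refine exists_forall_of_local h.d_ne_zero (Q := fun C z =>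
    √‖1 - z ^ d‖ ≤ C * (1 - ‖pgf a z‖) ∧ √‖1 - z ^ d‖ ≤ C * ‖1 - spineGen q a z‖ ∧
    ‖1 - spineGen q a z‖ ≤ C * (1 - ‖spineGen q a z‖)) ?_ ?_ ?_ ?_
  · rintro C C' z hCC hz ⟨h1, h2, h3⟩
    have e1 : 0 ≤ 1 - ‖pgf a z‖ := by linarith [h.norm_a_lt hz]
    have e2 : 0 ≤ 1 - ‖spineGen q a z‖ := by linarith [h.norm_spineGen_lt hz.le (h.norm_a_lt hz)]
    exact ⟨h1.trans (by gcongr), h2.trans (by gcongr), h3.trans (by gcongr)⟩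
  · intro C z ω hω hz hQ
    rw [h.pgf_a_mul hω, h.spineGen_mul hω, h.norm_root_mul hω, mul_pow, hω, one_mul]
    exact hQ
  · obtain ⟨C, hC⟩ := h.eventually_bounds
    refine ⟨max C 4, ?_⟩
    filter_upwards [hC, self_mem_nhdsWithin] with z hz hzb
    have hz1 : ‖z‖ < 1 := by simpa using hzb
    have e1 : 0 ≤ 1 - ‖pgf a z‖ := by linarith [h.norm_a_lt hz1]
    have e2 : 0 ≤ 1 - ‖spineGen q a z‖ := by
      linarith [h.norm_spineGen_lt hz1.le (h.norm_a_lt hz1)]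
    exact ⟨hz.1.trans (by gcongr; exact le_max_left _ _),
      hz.2.1.trans (by gcongr; exact le_max_left _ _),
      hz.2.2.1.trans (by gcongr; exact le_max_right _ _)⟩
  · intro z₀ hz₀ hne
    have hF := h.norm_a_lt_of_pow_ne hz₀ hne
    have hW := h.norm_spineGen_lt hz₀ hF
    have hmem : z₀ ∈ Metric.closedBall (0 : ℂ) 1 := by simpa using hz₀
    have cF := (h.continuousOn_a z₀ hmem).norm.tendsto.mono_left
      (nhdsWithin_mono _ Metric.ball_subset_closedBall)
    have cW := (h.continuousOn_spineGen z₀ hmem).norm.tendsto.mono_left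
      (nhdsWithin_mono _ Metric.ball_subset_closedBall)
    obtain ⟨r, hr1, hr2⟩ := exists_between (max_lt hF hW)
    have hr0 : 0 < 1 - r := by linarith
    refine ⟨2 / (1 - r), ?_⟩
    filter_upwards [cF.eventually_le_const ((le_max_left _ _).trans_lt hr1),
      cW.eventually_le_const ((le_max_right _ _).trans_lt hr1), self_mem_nhdsWithin]
      with z hzF hzW hzb
    have hz1 : ‖z‖ < 1 := by simpa using hzb
    have e3 : ∀ {t}, 1 - r ≤ t → 2 ≤ 2 / (1 - r) * t := fun {t} ht => by
      rw [div_mul_eq_mul_div, le_div_iff₀ hr0]; linarith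
    have e4 := norm_sub_norm_le (1 : ℂ) (spineGen q a z)
    have e5 := norm_sub_le (1 : ℂ) (spineGen q a z)
    rw [norm_one] at e4 e5
    exact ⟨(sqrt_norm_one_sub_pow_le hz1.le).trans (e3 (by linarith)),
      (sqrt_norm_one_sub_pow_le hz1.le).trans (e3 (by linarith)),
      (show _ ≤ (2 : ℝ) by linarith).trans (e3 (by linarith))⟩

lemma norm_treeGenDerivTwo_le {z : ℂ} (hz : ‖z‖ < 1) :
    ‖treeGenDerivTwo q a z‖ ≤ 2 * (‖1 - spineGen q a z‖ ^ 2)⁻¹ +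
      (∑' k, dcoeff (dcoeff q) k) * (‖1 - spineGen q a z‖ ^ 3)⁻¹ := by
  have h0 := h.norm_q_le (h.norm_a_le hz.le)
  have h1 := h.norm_dq_le (h.norm_a_le hz.le)
  have h2 := h.norm_ddq_le (h.norm_a_le hz.le)
  have hσ := h.ddq_pos
  rw [treeGenDerivTwo]
  refine (norm_add_le _ _).trans ?_
  simp only [norm_mul, norm_inv, norm_pow, div_eq_mul_inv]
  gcongr
  · rw [Complex.norm_ofNat]
    calc _ ≤ (2 : ℝ) * 1 * 1 := by gcongr
      _ = 2 := by norm_num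
  · calc _ ≤ 1 * (∑' k, dcoeff (dcoeff q) k) * 1 ^ 2 := by gcongr
      _ = _ := by ring

/-- `F''` is asymptotic to a positive multiple of the explicit comparison function. -/
lemma exists_treeGenDerivTwo_approx : ∃ κ : ℝ, 0 < κ ∧ ∀ ε : ℝ, 0 < ε → ∃ C, 0 ≤ C ∧
    ∀ z : ℂ, ‖z‖ < 1 →
      ‖treeGenDerivTwo q a z - κ * (z ^ (d - 1) * (sqrtOneSub d z ^ 3)⁻¹)‖ ≤
        ε * (√‖1 - z ^ d‖ ^ 3)⁻¹ + C := by
  obtain ⟨κ, hκ, hlim⟩ := h.tendsto_treeGenDerivTwo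
  refine ⟨κ, hκ, fun ε hε => ?_⟩
  have hd1 : d - 1 + 1 = d := Nat.sub_add_cancel (Nat.pos_of_ne_zero h.d_ne_zero)
  refine exists_forall_of_local h.d_ne_zero (Q := fun C z =>
    ‖treeGenDerivTwo q a z - κ * (z ^ (d - 1) * (sqrtOneSub d z ^ 3)⁻¹)‖ ≤
        ε * (√‖1 - z ^ d‖ ^ 3)⁻¹ + C) ?_ ?_ ?_ ?_
  · intro C C' z hCC hz h1
    exact h1.trans (by gcongr)
  · intro C z ω hω hz hQ
    have hS : sqrtOneSub d (ω * z) = sqrtOneSub d z := by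
      rw [sqrtOneSub, sqrtOneSub, mul_pow, hω, one_mul]
    have hωd : ω ^ (d - 1) = ω⁻¹ := eq_inv_of_mul_eq_one_left (by rw [← pow_succ, hd1, hω])
    have e : treeGenDerivTwo q a (ω * z) - κ * ((ω * z) ^ (d - 1) * (sqrtOneSub d (ω * z) ^ 3)⁻¹)
        = ω⁻¹ * (treeGenDerivTwo q a z - κ * (z ^ (d - 1) * (sqrtOneSub d z ^ 3)⁻¹)) := by
      rw [h.treeGenDerivTwo_mul hω, hS, mul_pow, hωd]; ring
    rw [e, norm_mul, norm_inv, Complex.norm_eq_one_of_pow_eq_one hω h.d_ne_zero, inv_one, one_mul,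
      mul_pow, hω, one_mul]
    exact hQ
  · refine ⟨0, ?_⟩
    have t1 : Tendsto (fun z : ℂ => (κ : ℂ) * z ^ (d - 1)) (𝓝[Metric.ball 0 1] 1) (𝓝 κ) := by
      have : Continuous fun z : ℂ => (κ : ℂ) * z ^ (d - 1) := by fun_prop
      simpa using (this.tendsto 1).mono_left nhdsWithin_le_nhds
    have t2 := (hlim.sub t1).norm
    rw [sub_self, norm_zero] at t2
    filter_upwards [t2.eventually_le_const hε, self_mem_nhdsWithin] with z hz hzb
    have hz1 : ‖z‖ < 1 := by simpa using hzb
    have hS := sqrtOneSub_ne_zero h.d_ne_zero hz1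
    have e : treeGenDerivTwo q a z - κ * (z ^ (d - 1) * (sqrtOneSub d z ^ 3)⁻¹) =
        (treeGenDerivTwo q a z * sqrtOneSub d z ^ 3 - κ * z ^ (d - 1)) *
          (sqrtOneSub d z ^ 3)⁻¹ := by field_simp
    rw [e, norm_mul, add_zero, norm_inv, norm_pow, norm_sqrtOneSub]
    gcongr
  · intro z₀ hz₀ hne
    obtain ⟨C, hC0, hC⟩ := h.exists_global_bounds
    have hpos : 0 < √‖1 - z₀ ^ d‖ :=
      Real.sqrt_pos.2 (norm_pos_iff.2 (sub_ne_zero.2 (Ne.symm hne)))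
    have hcont : Continuous fun z : ℂ => √‖1 - z ^ d‖ := by fun_prop
    obtain ⟨r, hr0, hr⟩ := exists_between hpos
    have hev := (hcont.tendsto z₀).eventually_const_le hr
    set σ := ∑' k, dcoeff (dcoeff q) k with hσ
    have hσ0 : 0 < σ := h.ddq_pos
    refine ⟨2 * ((r / (C + 1)) ^ 2)⁻¹ + σ * ((r / (C + 1)) ^ 3)⁻¹ + κ * (r ^ 3)⁻¹, ?_⟩
    filter_upwards [nhdsWithin_le_nhds hev, self_mem_nhdsWithin] with z hzr hzb
    have hz1 : ‖z‖ < 1 := by simpa using hzb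
    have hW : r / (C + 1) ≤ ‖1 - spineGen q a z‖ := by
      rw [div_le_iff₀ (by positivity)]
      nlinarith [(hC z hz1).2.1, norm_nonneg (1 - spineGen q a z)]
    have hpw : ‖z‖ ^ (d - 1) ≤ 1 := pow_le_one₀ (norm_nonneg _) hz1.le
    refine le_add_of_nonneg_of_le (by positivity) ((norm_sub_le _ _).trans (add_le_add
      ((h.norm_treeGenDerivTwo_le hz1).trans ?_) ?_))
    · gcongr
    · rw [norm_mul, norm_mul, norm_inv, norm_pow, norm_pow, norm_sqrtOneSub, Complex.norm_real,
        Real.norm_of_nonneg hκ.le]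
      gcongr
      calc _ ≤ 1 * (r ^ 3)⁻¹ := by gcongr
        _ = _ := one_mul _

lemma hasCoeffs_a : HasCoeffs (pgf a) fun n => a n := by
  filter_upwards [Metric.ball_mem_nhds (0 : ℂ) one_pos] with z hz
  exact hasSum_pgf h.a_nonneg h.a_summable (by simpa using (mem_ball_zero_iff.1 hz).le)

lemma differentiableOn_a : DifferentiableOn ℂ (pgf a) (Metric.ball 0 1) := fun z hz =>
  (h.hasDerivAt_a (by simpa using hz)).differentiableAt.differentiableWithinAt

lemma deriv_deriv_a {z : ℂ} (hz : ‖z‖ < 1) :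
    deriv (deriv (pgf a)) z = treeGenDerivTwo q a z := (h.hasDerivAt_deriv_a hz).deriv

lemma exists_coeff_lower_bound_of_ge : ∃ c : ℝ, 0 < c ∧ ∃ N, ∀ n, N ≤ n → n ≡ 1 [MOD d] →
    c ≤ a n * √n ^ 3 := by
  obtain ⟨κ, hκ, happrox⟩ := h.exists_treeGenDerivTwo_approx
  have hd0 : (0 : ℝ) < d := by exact_mod_cast Nat.pos_of_ne_zero h.d_ne_zero
  obtain ⟨C, hC0, hC⟩ := happrox (κ / (400 * √(2 * d))) (by positivity)
  have hcoeff : HasCoeffs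
      (fun z => deriv (deriv (pgf a)) z - κ * (z ^ (d - 1) * (sqrtOneSub d z ^ 3)⁻¹)) _ :=
    h.hasCoeffs_a.deriv.deriv.sub (c := fun n => κ * comparisonCoeff d n) (by
      filter_upwards [hasCoeffs_comparison h.d_ne_zero] with z hz
      simpa [mul_assoc] using hz.mul_left (κ : ℂ))
  have hdiff : DifferentiableOn ℂ
      (fun z => deriv (deriv (pgf a)) z - κ * (z ^ (d - 1) * (sqrtOneSub d z ^ 3)⁻¹))
      (Metric.ball 0 1) :=
    ((h.differentiableOn_a.deriv Metric.isOpen_ball).deriv Metric.isOpen_ball).sub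
      ((differentiableOn_comparison h.d_ne_zero).const_mul _)
  refine ⟨κ / (4 * √(2 * d)), by positivity, d * (Nat.ceil ((12 * C / κ) ^ 2) + 1) + 1,
    fun n hn hmod => ?_⟩
  obtain ⟨m, rfl⟩ : ∃ m, n = d * m + 1 := by
    obtain ⟨m, hm⟩ := (Nat.modEq_iff_dvd' (by omega)).1 hmod.symm
    exact ⟨m, by omega⟩
  have hm : Nat.ceil ((12 * C / κ) ^ 2) + 1 ≤ m :=
    Nat.le_of_mul_le_mul_left (by omega) (Nat.pos_of_ne_zero h.d_ne_zero)
  obtain ⟨j, rfl⟩ : ∃ j, m = j + 1 := ⟨m - 1, by omega⟩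
  have hind : d * (j + 1) + 1 = d * j + (d - 1) + 1 + 1 := by
    have := Nat.pos_of_ne_zero h.d_ne_zero
    rw [mul_add]; omega
  set n := d * (j + 1) + 1 with hn_def
  have hb := hcoeff.norm_le_sqrt hdiff h.d_ne_zero (M := κ / (400 * √(2 * d))) (by positivity) hC0
    (fun z hz => by rw [h.deriv_deriv_a hz]; exact hC z hz) (m := d * j + (d - 1)) (n := n)
    (by omega) (by omega)
  rw [comparisonCoeff_apply h.d_ne_zero] at hb
  have hreal : ((d * j + (d - 1) : ℕ) + 1 : ℂ) * ((((d * j + (d - 1) + 1 : ℕ) : ℂ) + 1) *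
      (a (d * j + (d - 1) + 1 + 1) : ℂ)) - κ * (threeHalvesCoeff j : ℂ) =
      (((n - 1) * (n * a n) - κ * threeHalvesCoeff j : ℝ) : ℂ) := by
    rw [hind]; push_cast; ring
  rw [hreal, Complex.norm_real] at hb
  rw [Real.norm_eq_abs] at hb
  have hb1 := (abs_le.1 hb).1
  have hT := sqrt_le_threeHalvesCoeff j
  set J : ℝ := √(j + 1) with hJ
  have hnJ : √n ≤ √(2 * d) * J := by
    rw [hJ, ← Real.sqrt_mul (by positivity)]
    refine Real.sqrt_le_sqrt ?_
    have : (1 : ℝ) ≤ d * (j + 1) := by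
      exact_mod_cast Nat.one_le_iff_ne_zero.2 (mul_ne_zero h.d_ne_zero (Nat.succ_ne_zero j))
    rw [hn_def]; push_cast; linarith
  have hJC : 12 * C / κ ≤ J := by
    rw [hJ]
    refine Real.le_sqrt_of_sq_le ((Nat.le_ceil _).trans ?_)
    have : (Nat.ceil ((12 * C / κ) ^ 2) : ℝ) ≤ j := by exact_mod_cast (by omega)
    linarith
  rw [div_le_iff₀ hκ] at hJC
  have hD : 0 < √(2 * (d : ℝ)) := by positivity
  have e1 : 200 * (κ / (400 * √(2 * d))) * √n ≤ κ * J / 2 := by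
    calc _ ≤ 200 * (κ / (400 * √(2 * d))) * (√(2 * d) * J) := by gcongr
      _ = _ := by field_simp; norm_num
  have e2 : κ * J ≤ κ * threeHalvesCoeff j := by gcongr
  have ha := h.a_nonneg n
  have hn1 : (1 : ℝ) ≤ n := by exact_mod_cast (show 1 ≤ n by omega)
  have hsn : √(n : ℝ) ^ 2 = n := Real.sq_sqrt (by positivity)
  have hsn0 : 0 < √(n : ℝ) := by positivity
  have e3 : κ * J / 4 ≤ n ^ 2 * a n := by
    have : ((n : ℝ) - 1) * (n * a n) ≤ n ^ 2 * a n := by nlinarith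
    linarith
  have e4 : κ / (4 * √(2 * d)) * √n ≤ a n * √n ^ 3 * √n := by
    calc _ ≤ κ / (4 * √(2 * d)) * (√(2 * d) * J) := by gcongr
      _ = κ * J / 4 := by field_simp
      _ ≤ n ^ 2 * a n := e3
      _ = (√(n : ℝ) ^ 2) ^ 2 * a n := by rw [hsn]
      _ = _ := by ring
  exact le_of_mul_le_mul_right e4 hsn0

/-- `P(|𝒯| = n) ≥ c n^(-3/2)` whenever it is non-zero. -/
lemma exists_coeff_lower_bound : ∃ c : ℝ, 0 < c ∧ ∀ n, 1 ≤ n → a n ≠ 0 → c ≤ a n * √n ^ 3 := by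
  obtain ⟨c, hc, N, hN⟩ := h.exists_coeff_lower_bound_of_ge
  have hsmall : ∀ N, ∃ c : ℝ, 0 < c ∧ ∀ n < N, 1 ≤ n → a n ≠ 0 → c ≤ a n * √n ^ 3 := by
    intro N
    induction N with
    | zero => exact ⟨1, one_pos, by simp⟩
    | succ N ih =>
      obtain ⟨c, hc, hN⟩ := ih
      by_cases hp : 0 < a N * √N ^ 3
      · refine ⟨min c (a N * √N ^ 3), lt_min hc hp, fun n hn h1 h2 => ?_⟩
        rcases Nat.lt_succ_iff_lt_or_eq.1 hn with hn | rfl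
        · exact (min_le_left _ _).trans (hN n hn h1 h2)
        · exact min_le_right _ _
      · refine ⟨c, hc, fun n hn h1 h2 => ?_⟩
        rcases Nat.lt_succ_iff_lt_or_eq.1 hn with hn | rfl
        · exact hN n hn h1 h2
        · have : 0 < a n := lt_of_le_of_ne (h.a_nonneg n) (Ne.symm h2)
          have : (0 : ℝ) < n := by exact_mod_cast h1
          exact absurd (by positivity) hp
  obtain ⟨c', hc', hN'⟩ := hsmall N
  refine ⟨min c c', lt_min hc hc', fun n h1 h2 => ?_⟩
  rcases lt_or_ge n N with hn | hn
  · exact (min_le_right _ _).trans (hN' n hn h1 h2)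
  · exact (min_le_left _ _).trans (hN n hn (h.modEq_of_ne_zero n h2))

end Global

end IsCriticalTreeSeries

section Delta

lemma exists_delta_norm_sub_one_le {η : ℝ} (hη : 0 < η) (hη1 : η ≤ 1) :
    ∃ β δ : ℝ, 0 < β ∧ β < Real.pi / 2 ∧ 0 < δ ∧ δ ≤ 1 ∧
      ∀ x ∈ Delta β δ, ‖x‖ - 1 ≤ η * ‖1 - x‖ := by
  have hpi := Real.pi_gt_three
  refine ⟨η / 2, η ^ 2, by positivity, by linarith, by positivity, by nlinarith, ?_⟩
  rintro x ⟨hx1, -, hx3⟩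
  rw [norm_sub_rev]
  have hre : (x - 1).re ≤ η / 2 * ‖x - 1‖ := by
    rw [← Complex.norm_mul_cos_arg, mul_comm]
    gcongr
    rw [← Real.cos_abs]
    refine (Real.cos_le_cos_of_nonneg_of_le_pi (by linarith)
      (Complex.abs_arg_le_pi _) hx3.le).trans ?_
    rw [Real.cos_pi_div_two_sub]
    exact Real.sin_le (by positivity)
  have hsq : ‖x‖ ^ 2 = 1 + 2 * (x - 1).re + ‖x - 1‖ ^ 2 := by
    rw [Complex.sq_norm, Complex.sq_norm, Complex.normSq_apply, Complex.normSq_apply]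
    simp; ring
  have hn := norm_nonneg (x - 1)
  rcases le_total ‖x - 1‖ η with hle | hle
  · nlinarith [sq_nonneg (‖x‖ - 1)]
  · nlinarith

/-- A Stolz-angle bound on `W` is inherited by `1 - x W` for `x` in a suitable Delta-domain. -/
lemma exists_delta_norm_one_sub_mul {M : ℝ} (hM : 1 ≤ M) :
    ∃ β δ : ℝ, 0 < β ∧ β < Real.pi / 2 ∧ 0 < δ ∧ δ ≤ 1 ∧
      ∀ x ∈ Delta β δ, ∀ w : ℂ, ‖w‖ < 1 → ‖1 - w‖ ≤ M * (1 - ‖w‖) →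
        ‖1 - w‖ ≤ 4 * M * ‖1 - x * w‖ ∧ ‖1 - x‖ ≤ 9 * M * ‖1 - x * w‖ := by
  have hM0 : 0 < M := by linarith
  obtain ⟨β, δ, h1, h2, h3, h4, hΔ⟩ := exists_delta_norm_sub_one_le (η := 1 / (4 * M))
    (by positivity) (by rw [div_le_one (by positivity)]; linarith)
  refine ⟨β, δ, h1, h2, h3, h4, fun x hx w hw hwM => ?_⟩
  have e1 := hΔ x hx
  have hx2 : ‖x‖ ≤ 2 := by linarith [hx.1]
  have e2 : 1 - ‖x‖ * ‖w‖ ≤ ‖1 - x * w‖ := by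
    have := norm_sub_norm_le 1 (x * w)
    rwa [norm_one, norm_mul] at this
  have e3 : ‖1 - x‖ ≤ ‖1 - x * w‖ + 2 * ‖1 - w‖ := by
    calc ‖1 - x‖ = ‖(1 - x * w) - x * (1 - w)‖ := by congr 1; ring
      _ ≤ ‖1 - x * w‖ + ‖x * (1 - w)‖ := norm_sub_le _ _
      _ ≤ _ := by rw [norm_mul]; gcongr
  have e4 : (‖x‖ - 1) * ‖w‖ ≤ 1 / (4 * M) * ‖1 - x‖ := by
    have h0 : 0 ≤ 1 / (4 * M) * ‖1 - x‖ := by positivity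
    nlinarith [norm_nonneg w]
  have e5 : M * ((1 - ‖w‖) - ‖1 - x * w‖) ≤ ‖1 - x‖ / 4 := by
    calc _ ≤ M * (1 / (4 * M) * ‖1 - x‖) := by gcongr; linarith
      _ = _ := by field_simp
  have e6 : ‖1 - w‖ ≤ 4 * M * ‖1 - x * w‖ := by
    nlinarith [norm_nonneg (1 - x * w), norm_nonneg (1 - w)]
  exact ⟨e6, by nlinarith [norm_nonneg (1 - x * w)]⟩

end Delta

/-- The generating function of `∑_v x^{|v|}` over weighted trees. -/
noncomputable def pathGen (q a : ℕ → ℝ) (x z : ℂ) : ℂ := pgf a z / (1 - x * spineGen q a z)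

/-- The generating function of `∑_{v,w} x^{d(v, v ∧ w)} y^{d(w, v ∧ w)}` over weighted trees. -/
noncomputable def pairGen (q a : ℕ → ℝ) (x y z : ℂ) : ℂ :=
  (pathGen q a x z + pathGen q a y z - pgf a z +
    x * y * z * pgf (dcoeff (dcoeff q)) (pgf a z) * pathGen q a x z * pathGen q a y z) /
    (1 - spineGen q a z)

/-- The derivative of `F`, expressed through `F` itself. -/
noncomputable def treeGenDeriv (q a : ℕ → ℝ) (z : ℂ) : ℂ :=
  pgf q (pgf a z) * (1 - spineGen q a z)⁻¹

/-- The derivative of `spineGen`. -/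
noncomputable def spineGenDeriv (q a : ℕ → ℝ) (z : ℂ) : ℂ :=
  pgf (dcoeff q) (pgf a z) + z * (pgf (dcoeff (dcoeff q)) (pgf a z) * treeGenDeriv q a z)

/-- The derivative of `pathGen`. -/
noncomputable def pathGenDeriv (q a : ℕ → ℝ) (x z : ℂ) : ℂ :=
  treeGenDeriv q a z * (1 - x * spineGen q a z)⁻¹ +
    pgf a z * (1 - x * spineGen q a z)⁻¹ * (x * spineGenDeriv q a z * (1 - x * spineGen q a z)⁻¹)

/-- The derivative of `pairGen`. -/
noncomputable def pairGenDeriv (q a : ℕ → ℝ) (x y z : ℂ) : ℂ :=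
  (pathGenDeriv q a x z + pathGenDeriv q a y z - treeGenDeriv q a z +
    x * y * (pgf (dcoeff (dcoeff q)) (pgf a z) * (pathGen q a x z * pathGen q a y z) +
      z * (pgf (dcoeff (dcoeff (dcoeff q))) (pgf a z) * treeGenDeriv q a z *
          (pathGen q a x z * pathGen q a y z) +
        pgf (dcoeff (dcoeff q)) (pgf a z) * (pathGenDeriv q a x z * pathGen q a y z +
          pathGen q a x z * pathGenDeriv q a y z)))) * (1 - spineGen q a z)⁻¹ +
  (pathGen q a x z + pathGen q a y z - pgf a z + x * y * (z * (pgf (dcoeff (dcoeff q)) (pgf a z) *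
    (pathGen q a x z * pathGen q a y z)))) *
    (spineGenDeriv q a z * ((1 - spineGen q a z)⁻¹ * (1 - spineGen q a z)⁻¹))

namespace IsCriticalTreeSeries

variable {q a : ℕ → ℝ} {d : ℕ}

section PairGen

variable (h : IsCriticalTreeSeries q a d)
include h

lemma hasDerivAt_a' {z : ℂ} (hz : ‖z‖ < 1) : HasDerivAt (pgf a) (treeGenDeriv q a z) z := by
  have := h.hasDerivAt_a hz
  rwa [div_eq_mul_inv] at this

lemma hasDerivAt_spineGen' {z : ℂ} (hz : ‖z‖ < 1) :
    HasDerivAt (spineGen q a) (spineGenDeriv q a z) z := by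
  have := h.hasDerivAt_spineGen hz
  rwa [div_eq_mul_inv] at this

lemma hasDerivAt_pathGen {x z : ℂ} (hz : ‖z‖ < 1) (hx : 1 - x * spineGen q a z ≠ 0) :
    HasDerivAt (pathGen q a x) (pathGenDeriv q a x z) z := by
  have h1 := (h.hasDerivAt_a' hz).div (((h.hasDerivAt_spineGen' hz).const_mul x).const_sub 1) hx
  convert! h1 using 1
  rw [pathGenDeriv]
  field_simp
  ring

lemma hasDerivAt_pairGen {x y z : ℂ} (hz : ‖z‖ < 1) (hx : 1 - x * spineGen q a z ≠ 0)
    (hy : 1 - y * spineGen q a z ≠ 0) :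
    HasDerivAt (pairGen q a x y) (pairGenDeriv q a x y z) z := by
  have hW := h.one_sub_spineGen_ne_zero hz
  have hF := h.hasDerivAt_a' hz
  have hX := h.hasDerivAt_pathGen hz hx
  have hY := h.hasDerivAt_pathGen hz hy
  have hΦ := (hasDerivAt_pgf h.ddq_nonneg h.ddq_summable (h.norm_a_lt hz)).comp z hF
  have h1 := (((hX.add hY).sub hF).add (((((hasDerivAt_id' z).const_mul (x * y)).mul hΦ).mul
    hX).mul hY)).div ((h.hasDerivAt_spineGen' hz).const_sub 1) hW
  convert! h1 using 1
  simp only [pairGenDeriv, Function.comp, Pi.add_apply, Pi.sub_apply, Pi.mul_apply]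
  field_simp
  ring

end PairGen

end IsCriticalTreeSeries

namespace IsCriticalTreeSeries

variable {q a : ℕ → ℝ} {d : ℕ}

section PairGenBound

open Asymptotics

variable (h : IsCriticalTreeSeries q a d)
include h

/-- The uniform lower bounds available for `x` in a suitable Delta-domain. -/
lemma exists_delta_bounds : ∃ C β δ : ℝ, 0 < C ∧ 0 < β ∧ β < Real.pi / 2 ∧ 0 < δ ∧ δ ≤ 1 ∧
    (∀ z : ℂ, ‖z‖ < 1 → √‖1 - z ^ d‖ ≤ C * (1 - ‖pgf a z‖) ∧
      √‖1 - z ^ d‖ ≤ C * ‖1 - spineGen q a z‖) ∧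
    ∀ x ∈ Delta β δ, ∀ z : ℂ, ‖z‖ < 1 → 1 - x * spineGen q a z ≠ 0 ∧
      √‖1 - z ^ d‖ ≤ C * ‖1 - x * spineGen q a z‖ ∧ ‖1 - x‖ ≤ C * ‖1 - x * spineGen q a z‖ := by
  obtain ⟨M, hM0, hM⟩ := h.exists_global_bounds
  obtain ⟨β, δ, h1, h2, h3, h4, hΔ⟩ := exists_delta_norm_one_sub_mul (M := M + 1) (by linarith)
  refine ⟨9 * (M + 1) ^ 2, β, δ, by positivity, h1, h2, h3, h4, fun z hz => ?_,
    fun x hx z hz => ?_⟩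
  · obtain ⟨e1, e2, -⟩ := hM z hz
    have : 0 ≤ 1 - ‖pgf a z‖ := by linarith [h.norm_a_lt hz]
    exact ⟨e1.trans (by gcongr; nlinarith), e2.trans (by gcongr; nlinarith)⟩
  · obtain ⟨-, e2, e3⟩ := hM z hz
    have hW := h.norm_spineGen_lt hz.le (h.norm_a_lt hz)
    obtain ⟨e4, e5⟩ := hΔ x hx _ hW (e3.trans (by gcongr; linarith))
    refine ⟨fun h0 => ?_, ?_, e5.trans (by gcongr; nlinarith)⟩
    · rw [h0, norm_zero, mul_zero] at e4
      exact h.one_sub_spineGen_ne_zero hz (norm_le_zero_iff.1 e4)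
    · calc _ ≤ M * ‖1 - spineGen q a z‖ := e2
        _ ≤ M * (4 * (M + 1) * ‖1 - x * spineGen q a z‖) := by gcongr
        _ = M * (4 * (M + 1)) * ‖1 - x * spineGen q a z‖ := by ring
        _ ≤ _ := mul_le_mul_of_nonneg_right (by nlinarith) (norm_nonneg _)

lemma exists_pairGenDeriv_bound : ∃ C β δ : ℝ, 0 < C ∧ 0 < β ∧ β < Real.pi / 2 ∧ 0 < δ ∧ δ ≤ 1 ∧
    (∀ x ∈ Delta β δ, ∀ z : ℂ, ‖z‖ < 1 → 1 - x * spineGen q a z ≠ 0) ∧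
    ∀ x ∈ Delta β δ, ∀ y ∈ Delta β δ, ∀ z : ℂ, ‖z‖ < 1 →
      ‖pairGenDeriv q a x y z‖ ≤ C / (‖1 - x‖ * ‖1 - y‖) * (√‖1 - z ^ d‖ ^ 3)⁻¹ := by
  obtain ⟨M, β, δ, hM0, h1, h2, h3, h4, hM, hΔ⟩ := h.exists_delta_bounds
  set S : Set (ℂ × ℂ × ℂ) := {t | t.1 ∈ Delta β δ ∧ t.2.1 ∈ Delta β δ ∧ ‖t.2.2‖ < 1} with hS
  set i : ℂ × ℂ × ℂ → ℝ := fun t => (√‖1 - t.2.2 ^ d‖)⁻¹ with hi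
  set X : ℂ × ℂ × ℂ → ℝ := fun t => ‖1 - t.1‖⁻¹ with hX
  set Y : ℂ × ℂ × ℂ → ℝ := fun t => ‖1 - t.2.1‖⁻¹ with hY
  have hspos : ∀ z : ℂ, ‖z‖ < 1 → 0 < √‖1 - z ^ d‖ := fun z hz => by
    rw [← norm_sqrtOneSub]; exact norm_pos_iff.2 (sqrtOneSub_ne_zero h.d_ne_zero hz)
  have hΔpos : ∀ x ∈ Delta β δ, 0 < ‖1 - x‖ := fun x hx =>
    norm_pos_iff.2 (sub_ne_zero.2 (Ne.symm hx.2.1))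
  have hΔn : ∀ x ∈ Delta β δ, ‖x‖ ≤ 2 := fun x hx => by linarith [hx.1]
  have of_bound : ∀ {E : Type} [NormedAddCommGroup E] {f : ℂ × ℂ × ℂ → E} (c : ℝ)
      {g : ℂ × ℂ × ℂ → ℝ}, (∀ t ∈ S, ‖f t‖ ≤ c * g t) → f =O[𝓟 S] g := by
    intro E _ f c g hf
    exact isBigO_principal.2 ⟨|c|, fun t ht => (hf t ht).trans
      ((le_abs_self _).trans (by rw [abs_mul, Real.norm_eq_abs]))⟩
  have inv_bound : ∀ {u v : ℝ}, 0 < u → u ≤ M * v → v⁻¹ ≤ M * u⁻¹ := fun {u v} hu huv => by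
    have hv : 0 < v := pos_of_mul_pos_right (hu.trans_le huv) hM0.le
    rw [inv_le_comm₀ hv (by positivity), mul_inv, inv_inv, inv_mul_le_iff₀ hM0]
    exact huv
  have one_i : (fun _ => (1 : ℝ)) =O[𝓟 S] i := of_bound 2 fun t ht => by
    have := sqrt_norm_one_sub_pow_le (d := d) ht.2.2.le
    rw [norm_one, hi, ← div_eq_mul_inv, one_le_div (hspos _ ht.2.2)]
    exact this
  have one_le : ∀ x ∈ Delta β δ, (1 : ℝ) ≤ 3 * ‖1 - x‖⁻¹ := fun x hx => by
    rw [← div_eq_mul_inv, one_le_div (hΔpos x hx)]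
    refine (norm_sub_le _ _).trans ?_
    rw [norm_one]; linarith [hΔn x hx]
  have one_X : (fun _ => (1 : ℝ)) =O[𝓟 S] X := of_bound 3 fun t ht => by
    rw [norm_one]; exact one_le _ ht.1
  have one_Y : (fun _ => (1 : ℝ)) =O[𝓟 S] Y := of_bound 3 fun t ht => by
    rw [norm_one]; exact one_le _ ht.2.1
  have bz : (fun t : ℂ × ℂ × ℂ => t.2.2) =O[𝓟 S] fun _ => (1 : ℝ) := of_bound 1 fun t ht => by
    simpa using ht.2.2.le
  have bF : (fun t : ℂ × ℂ × ℂ => pgf a t.2.2) =O[𝓟 S] fun _ => (1 : ℝ) := of_bound 1 fun t ht => by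
    simpa using h.norm_a_le ht.2.2.le
  have bq : (fun t : ℂ × ℂ × ℂ => pgf q (pgf a t.2.2)) =O[𝓟 S] fun _ => (1 : ℝ) :=
    of_bound 1 fun t ht => by simpa using h.norm_q_le (h.norm_a_le ht.2.2.le)
  have bdq : (fun t : ℂ × ℂ × ℂ => pgf (dcoeff q) (pgf a t.2.2)) =O[𝓟 S] fun _ => (1 : ℝ) :=
    of_bound 1 fun t ht => by simpa using h.norm_dq_le (h.norm_a_le ht.2.2.le)
  have bddq : (fun t : ℂ × ℂ × ℂ => pgf (dcoeff (dcoeff q)) (pgf a t.2.2)) =O[𝓟 S]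
      fun _ => (1 : ℝ) :=
    of_bound _ fun t ht => by simpa using h.norm_ddq_le (h.norm_a_le ht.2.2.le)
  have bdddq : (fun t : ℂ × ℂ × ℂ => pgf (dcoeff (dcoeff (dcoeff q))) (pgf a t.2.2)) =O[𝓟 S] i :=
    of_bound ((∑' k, dcoeff (dcoeff q) k) * M) fun t ht => by
      have e1 := norm_pgf_dcoeff_le h.ddq_nonneg h.ddq_summable (h.norm_a_lt ht.2.2)
      have e2 : 0 < 1 - ‖pgf a t.2.2‖ := by linarith [h.norm_a_lt ht.2.2]
      rw [← le_div_iff₀ e2, div_eq_mul_inv] at e1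
      refine e1.trans ?_
      rw [mul_assoc]
      have := h.ddq_pos
      gcongr
      exact inv_bound (hspos _ ht.2.2) (hM _ ht.2.2).1
  have bW : (fun t : ℂ × ℂ × ℂ => (1 - spineGen q a t.2.2)⁻¹) =O[𝓟 S] i := of_bound M fun t ht => by
    rw [norm_inv]; exact inv_bound (hspos _ ht.2.2) (hM _ ht.2.2).2
  have bx : (fun t : ℂ × ℂ × ℂ => t.1) =O[𝓟 S] fun _ => (1 : ℝ) := of_bound 2 fun t ht => by
    simpa using hΔn _ ht.1
  have bY : (fun t : ℂ × ℂ × ℂ => t.2.1) =O[𝓟 S] fun _ => (1 : ℝ) := of_bound 2 fun t ht => by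
    simpa using hΔn _ ht.2.1
  have bxX : (fun t : ℂ × ℂ × ℂ => (1 - t.1 * spineGen q a t.2.2)⁻¹) =O[𝓟 S] X :=
    of_bound M fun t ht => by
      rw [norm_inv]; exact inv_bound (hΔpos _ ht.1) (hΔ _ ht.1 _ ht.2.2).2.2
  have byY : (fun t : ℂ × ℂ × ℂ => (1 - t.2.1 * spineGen q a t.2.2)⁻¹) =O[𝓟 S] Y :=
    of_bound M fun t ht => by
      rw [norm_inv]; exact inv_bound (hΔpos _ ht.2.1) (hΔ _ ht.2.1 _ ht.2.2).2.2
  have bxi : (fun t : ℂ × ℂ × ℂ => (1 - t.1 * spineGen q a t.2.2)⁻¹) =O[𝓟 S] i :=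
    of_bound M fun t ht => by
      rw [norm_inv]; exact inv_bound (hspos _ ht.2.2) (hΔ _ ht.1 _ ht.2.2).2.1
  have byi : (fun t : ℂ × ℂ × ℂ => (1 - t.2.1 * spineGen q a t.2.2)⁻¹) =O[𝓟 S] i :=
    of_bound M fun t ht => by
      rw [norm_inv]; exact inv_bound (hspos _ ht.2.2) (hΔ _ ht.2.1 _ ht.2.2).2.1
  have bF' : (fun t : ℂ × ℂ × ℂ => treeGenDeriv q a t.2.2) =O[𝓟 S] i :=
    (bq.mul bW).congr_right fun t => one_mul _
  have bW' : (fun t : ℂ × ℂ × ℂ => spineGenDeriv q a t.2.2) =O[𝓟 S] i :=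
    (bdq.trans one_i).add ((bz.mul (bddq.mul bF')).congr_right fun t => by ring)
  have bG : ∀ {ξ : ℂ × ℂ × ℂ → ℂ} {Z : ℂ × ℂ × ℂ → ℝ},
      (fun t => (1 - ξ t * spineGen q a t.2.2)⁻¹) =O[𝓟 S] Z →
      (fun t => pathGen q a (ξ t) t.2.2) =O[𝓟 S] Z := fun hZ =>
    (bF.mul hZ).congr (fun t => (div_eq_mul_inv _ _).symm) fun t => one_mul _
  have bG' : ∀ {ξ : ℂ × ℂ × ℂ → ℂ} {Z : ℂ × ℂ × ℂ → ℝ}, ξ =O[𝓟 S] (fun _ => (1 : ℝ)) →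
      (fun t => (1 - ξ t * spineGen q a t.2.2)⁻¹) =O[𝓟 S] Z →
      (fun t => (1 - ξ t * spineGen q a t.2.2)⁻¹) =O[𝓟 S] i →
      (fun t => pathGenDeriv q a (ξ t) t.2.2) =O[𝓟 S] fun t => i t * i t * Z t :=
    fun {ξ Z} hξ hZ hZi => by
      refine IsBigO.add ?_ ?_
      · refine (bF'.mul hZ).trans ?_
        exact (one_i.mul (isBigO_refl (fun t => i t * Z t) _)).congr (fun t => one_mul _)
          fun t => by ring
      · exact ((bF.mul hZ).mul ((hξ.mul bW').mul hZi)).congr_right fun t => by ring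
  have X_P : X =O[𝓟 S] fun t => X t * Y t :=
    ((isBigO_refl X _).mul one_Y).congr_left fun t => mul_one _
  have Y_P : Y =O[𝓟 S] fun t => X t * Y t :=
    (one_X.mul (isBigO_refl Y _)).congr_left fun t => one_mul _
  have one_P : (fun _ => (1 : ℝ)) =O[𝓟 S] fun t => X t * Y t := one_X.trans X_P
  have one_ii : (fun _ => (1 : ℝ)) =O[𝓟 S] fun t => i t * i t :=
    (one_i.mul one_i).congr_left fun t => one_mul _
  have i_ii : i =O[𝓟 S] fun t => i t * i t :=
    ((isBigO_refl i _).mul one_i).congr_left fun t => mul_one _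
  have bGG := (bG bxX).mul (bG byY)
  have bxy := bx.mul bY
  have bN : (fun t : ℂ × ℂ × ℂ => pathGen q a t.1 t.2.2 + pathGen q a t.2.1 t.2.2 - pgf a t.2.2 +
      t.1 * t.2.1 * (t.2.2 * (pgf (dcoeff (dcoeff q)) (pgf a t.2.2) *
        (pathGen q a t.1 t.2.2 * pathGen q a t.2.1 t.2.2)))) =O[𝓟 S] fun t => X t * Y t :=
    ((((bG bxX).trans X_P).add ((bG byY).trans Y_P)).sub (bF.trans one_P)).add
      ((bxy.mul (bz.mul (bddq.mul bGG))).congr_right fun t => by ring)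
  have bN' : (fun t : ℂ × ℂ × ℂ =>
      pathGenDeriv q a t.1 t.2.2 + pathGenDeriv q a t.2.1 t.2.2 - treeGenDeriv q a t.2.2 +
      t.1 * t.2.1 * (pgf (dcoeff (dcoeff q)) (pgf a t.2.2) *
          (pathGen q a t.1 t.2.2 * pathGen q a t.2.1 t.2.2) +
        t.2.2 * (pgf (dcoeff (dcoeff (dcoeff q))) (pgf a t.2.2) * treeGenDeriv q a t.2.2 *
            (pathGen q a t.1 t.2.2 * pathGen q a t.2.1 t.2.2) +
          pgf (dcoeff (dcoeff q)) (pgf a t.2.2) *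
            (pathGenDeriv q a t.1 t.2.2 * pathGen q a t.2.1 t.2.2 +
              pathGen q a t.1 t.2.2 * pathGenDeriv q a t.2.1 t.2.2))))
      =O[𝓟 S] fun t => i t * i t * (X t * Y t) := by
    refine IsBigO.add (IsBigO.sub (IsBigO.add ?_ ?_) ?_) ?_
    · exact (bG' bx bxX bxi).trans ((isBigO_refl _ _).mul X_P)
    · exact (bG' bY byY byi).trans ((isBigO_refl _ _).mul Y_P)
    · exact bF'.trans ((i_ii.mul one_P).congr_left fun t => mul_one _)
    · refine (bxy.mul (IsBigO.add (g := fun t => i t * i t * (X t * Y t)) ?_ ((bz.mul (IsBigO.add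
        (g := fun t => i t * i t * (X t * Y t)) ?_ ?_)).congr_right fun t => one_mul _))).congr_right
          fun t => by ring
      · exact (bddq.trans one_ii).mul bGG
      · exact (bdddq.mul bF').mul bGG
      · refine (bddq.mul (IsBigO.add (g := fun t => i t * i t * (X t * Y t)) ?_ ?_)).congr_right
          fun t => one_mul _
        · exact ((bG' bx bxX bxi).mul (bG byY)).congr_right fun t => by ring
        · exact ((bG bxX).mul (bG' bY byY byi)).congr_right fun t => by ring
  have bH : (fun t : ℂ × ℂ × ℂ => pairGenDeriv q a t.1 t.2.1 t.2.2) =O[𝓟 S]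
      fun t => X t * Y t * i t ^ 3 :=
    ((bN'.mul bW).congr_right fun t => by ring).add
      ((bN.mul (bW'.mul (bW.mul bW))).congr_right fun t => by ring)
  obtain ⟨C, hC⟩ := isBigO_principal.1 bH
  refine ⟨|C| + 1, β, δ, by positivity, h1, h2, h3, h4, fun x hx z hz => (hΔ x hx z hz).1,
    fun x hx y hy z hz => (hC (x, y, z) ⟨hx, hy, hz⟩).trans ?_⟩
  simp only [hX, hY, hi, norm_mul, norm_inv, norm_pow, norm_norm, div_eq_mul_inv, mul_inv]
  rw [Real.norm_of_nonneg (Real.sqrt_nonneg _), inv_pow, ← mul_assoc]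
  exact mul_le_mul_of_nonneg_right (mul_le_mul_of_nonneg_right (by linarith [le_abs_self C])
    (by positivity)) (by positivity)

/-- Coefficient bound for `pairGen`, relative to the coefficients of the tree series. -/
theorem exists_coeff_bound : ∃ C β δ : ℝ, 0 < C ∧ 0 < β ∧ β < Real.pi / 2 ∧ 0 < δ ∧ δ ≤ 1 ∧
    ∀ x ∈ Delta β δ, ∀ y ∈ Delta β δ, ∀ b, HasCoeffs (pairGen q a x y) b →
      ∀ n, 1 ≤ n → a n ≠ 0 → ‖b n‖ / a n ≤ C * n / (‖1 - x‖ * ‖1 - y‖) := by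
  obtain ⟨C, β, δ, hC0, h1, h2, h3, h4, hne, hC⟩ := h.exists_pairGenDeriv_bound
  obtain ⟨c, hc0, hc⟩ := h.exists_coeff_lower_bound
  refine ⟨200 * C / c, β, δ, by positivity, h1, h2, h3, h4, fun x hx y hy b hb n hn han => ?_⟩
  have hderiv : ∀ z : ℂ, ‖z‖ < 1 → HasDerivAt (pairGen q a x y) (pairGenDeriv q a x y z) z :=
    fun z hz => h.hasDerivAt_pairGen hz (hne x hx z hz) (hne y hy z hz)
  have hdiff : DifferentiableOn ℂ (pairGen q a x y) (Metric.ball 0 1) := fun z hz =>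
    (hderiv z (by simpa using hz)).differentiableAt.differentiableWithinAt
  have hXY : 0 < ‖1 - x‖ * ‖1 - y‖ := mul_pos
    (norm_pos_iff.2 (sub_ne_zero.2 (Ne.symm hx.2.1)))
    (norm_pos_iff.2 (sub_ne_zero.2 (Ne.symm hy.2.1)))
  have key := hb.deriv.norm_le_sqrt (hdiff.deriv Metric.isOpen_ball) h.d_ne_zero
    (M := C / (‖1 - x‖ * ‖1 - y‖)) (M' := 0) (by positivity) le_rfl
    (fun z hz => by rw [(hderiv z hz).deriv, add_zero]; exact hC x hx y hy z hz)
    (m := n - 1) (n := n) hn (Nat.sub_le _ _)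
  have e1 : ((n - 1 : ℕ) : ℂ) + 1 = n := by exact_mod_cast Nat.sub_add_cancel hn
  rw [e1, Nat.sub_add_cancel hn, norm_mul, Complex.norm_natCast, mul_zero, add_zero] at key
  have han' : 0 < a n := lt_of_le_of_ne (h.a_nonneg n) (Ne.symm han)
  have hn0 : (0 : ℝ) < n := by exact_mod_cast hn
  have hs : √(n : ℝ) ^ 2 = n := Real.sq_sqrt hn0.le
  have hs0 : 0 < √(n : ℝ) := Real.sqrt_pos.2 hn0
  have hcn := hc n hn han
  rw [div_le_div_iff₀ han' hXY]
  have e2 : ‖b n‖ * (‖1 - x‖ * ‖1 - y‖) * √n ≤ 200 * C := by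
    refine le_of_mul_le_mul_right ?_ hs0
    calc _ = n * ‖b n‖ * (‖1 - x‖ * ‖1 - y‖) := by
          nth_rewrite 3 [← hs]; ring
      _ ≤ 200 * (C / (‖1 - x‖ * ‖1 - y‖)) * √n * (‖1 - x‖ * ‖1 - y‖) := by gcongr
      _ = 200 * (C / (‖1 - x‖ * ‖1 - y‖) * (‖1 - x‖ * ‖1 - y‖)) * √n := by ring
      _ = _ := by rw [div_mul_cancel₀ _ hXY.ne']
  refine le_of_mul_le_mul_right ?_ hs0
  calc _ ≤ 200 * C := e2
    _ = 200 * C / c * c := by field_simp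
    _ ≤ 200 * C / c * (a n * √n ^ 3) := by gcongr
    _ = 200 * C / c * √n ^ 2 * a n * √n := by ring
    _ = _ := by rw [hs]

end PairGenBound

end IsCriticalTreeSeries

namespace PlaneTree

variable {k : ℕ}

/-- The tree whose root has the given subtrees. -/
def graft (f : Fin k → PlaneTree) : PlaneTree := node (List.ofFn f)

/-- A tree is determined by the tuple of subtrees hanging off the root. -/
def graftEquiv : (Σ k, Fin k → PlaneTree) ≃ PlaneTree :=
  List.equivSigmaTuple.symm.trans ⟨node, children, fun _ => rfl, fun ⟨_⟩ => rfl⟩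

lemma induction_node {P : PlaneTree → Prop}
    (hP : ∀ ts : List PlaneTree, (∀ t ∈ ts, P t) → P (node ts)) :
    ∀ t, P t
  | node ts => hP ts fun t _ => induction_node hP t

lemma induction_graft {P : PlaneTree → Prop}
    (hP : ∀ (k : ℕ) (f : Fin k → PlaneTree), (∀ i, P (f i)) → P (graft f)) (t : PlaneTree) : P t :=
  induction_node (fun ts hts => by
    have := hP ts.length ts.get fun i => hts _ (List.get_mem ts i)
    rwa [graft, List.ofFn_get] at this) t

lemma subtreeAt_graft_cons (f : Fin k → PlaneTree) (i : Fin k) (v : List ℕ) :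
    subtreeAt (graft f) (i :: v) = subtreeAt (f i) v := by
  simp [graft, subtreeAt]

lemma nil_mem_vertexSet (t : PlaneTree) : [] ∈ vertexSet t := by
  simp [vertexSet, subtreeAt]

lemma vertexSet_graft (f : Fin k → PlaneTree) :
    vertexSet (graft f) = insert [] (⋃ i : Fin k, (fun v => (i : ℕ) :: v) '' vertexSet (f i)) := by
  ext v
  rcases v with _ | ⟨i, v⟩
  · simp [nil_mem_vertexSet]
  · simp only [mem_insert_iff, reduceCtorEq, false_or, mem_iUnion, mem_image, List.cons.injEq]
    constructor
    · intro hv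
      have hi : i < k := by
        by_contra hi
        simp [vertexSet, graft, subtreeAt, hi] at hv
      refine ⟨⟨i, hi⟩, v, ?_, rfl, rfl⟩
      rwa [vertexSet, mem_ofPred_eq, ← subtreeAt_graft_cons f ⟨i, hi⟩]
    · rintro ⟨j, w, hw, rfl, rfl⟩
      rwa [vertexSet, mem_ofPred_eq, subtreeAt_graft_cons]

lemma finite_vertexSet (t : PlaneTree) : (vertexSet t).Finite := by
  induction t using induction_graft with
  | hP k f ih =>
    rw [vertexSet_graft]
    exact (finite_iUnion fun i => (ih i).image _).insert _

@[to_additive]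
lemma finprod_mem_vertexSet_graft {M : Type*} [CommMonoid M] (f : Fin k → PlaneTree)
    (g : List ℕ → M) : ∏ᶠ v ∈ vertexSet (graft f), g v =
      g [] * ∏ i : Fin k, ∏ᶠ v ∈ vertexSet (f i), g (i :: v) := by
  have hfin : ∀ i : Fin k, ((fun v => (i : ℕ) :: v) '' vertexSet (f i)).Finite := fun i =>
    (finite_vertexSet _).image _
  rw [vertexSet_graft, finprod_mem_insert _ (by simp) (finite_iUnion hfin),
    finprod_mem_iUnion _ hfin, finprod_eq_prod_of_fintype]
  · congr 1
    exact Finset.prod_congr rfl fun i _ =>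
      finprod_mem_image fun v _ w _ hvw => (List.cons.inj hvw).2
  · intro i j hij
    refine Set.disjoint_left.2 ?_
    rintro _ ⟨v, -, rfl⟩ ⟨w, -, hw⟩
    exact hij (Fin.ext (List.cons.inj hw).1.symm)

lemma size_eq_finsum (t : PlaneTree) : size t = ∑ᶠ _v ∈ vertexSet t, 1 :=
  finsum_one.symm

lemma size_graft (f : Fin k → PlaneTree) : size (graft f) = 1 + ∑ i, size (f i) := by
  simp only [size_eq_finsum, finsum_mem_vertexSet_graft]

lemma childCount_graft_cons (f : Fin k → PlaneTree) (i : Fin k) (v : List ℕ) :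
    childCount (graft f) (i :: v) = childCount (f i) v := by
  rw [childCount, subtreeAt_graft_cons, childCount]

lemma childCount_graft_nil (f : Fin k → PlaneTree) : childCount (graft f) [] = k := by
  simp [childCount, subtreeAt, graft, children]

/-- The generating polynomial of the depths of the vertices. -/
noncomputable def depthSum {R : Type*} [CommSemiring R] (x : R) (t : PlaneTree) : R :=
  ∑ᶠ v ∈ vertexSet t, x ^ v.length

lemma depthSum_graft {R : Type*} [CommSemiring R] (x : R) (f : Fin k → PlaneTree) :
    depthSum x (graft f) = 1 + ∑ i, x * depthSum x (f i) := by
  simp only [depthSum, finsum_mem_vertexSet_graft, List.length_nil, pow_zero, List.length_cons,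
    pow_succ']
  congr 1
  exact Finset.sum_congr rfl fun i _ => (mul_finsum_mem' _ _ (finite_vertexSet _)).symm

/-- The sum over ordered pairs of vertices defining `hGen`. -/
noncomputable def pairSum (x y : ℂ) (t : PlaneTree) : ℂ :=
  ∑ᶠ v ∈ vertexSet t, ∑ᶠ w ∈ vertexSet t, x ^ dUp v w * y ^ dUp w v

end PlaneTree

lemma lca_nil_right (v : List ℕ) : lca v [] = [] := by cases v <;> simp [lca]

lemma dUp_nil_left (w : List ℕ) : dUp [] w = 0 := by simp [dUp]

lemma dUp_nil_right (v : List ℕ) : dUp v [] = v.length := by simp [dUp, lca_nil_right]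

lemma dUp_cons_self (i : ℕ) (v w : List ℕ) : dUp (i :: v) (i :: w) = dUp v w := by
  simp [dUp, lca]

lemma dUp_cons_of_ne {i j : ℕ} (hij : i ≠ j) (v w : List ℕ) :
    dUp (i :: v) (j :: w) = v.length + 1 := by
  simp [dUp, lca, hij]

lemma dUp_le (v w : List ℕ) : dUp v w ≤ v.length := Nat.sub_le _ _

namespace PlaneTree

variable {k : ℕ}

lemma pairSum_graft (x y : ℂ) (f : Fin k → PlaneTree) :
    pairSum x y (graft f) = 1 + ∑ i, y * depthSum y (f i) + ∑ i, x * depthSum x (f i) +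
      ∑ i, pairSum x y (f i) +
      ∑ i, ∑ j ∈ Finset.univ.erase i, x * y * (depthSum x (f i) * depthSum y (f j)) := by
  have hroot : ∑ᶠ w ∈ vertexSet (graft f), x ^ dUp [] w * y ^ dUp w [] =
      1 + ∑ i, y * depthSum y (f i) := by
    rw [← depthSum_graft]
    simp only [dUp_nil_left, dUp_nil_right, pow_zero, one_mul, depthSum]
  have hij : ∀ (i j : Fin k) (v : List ℕ), i ≠ j →
      ∑ᶠ w ∈ vertexSet (f j), x ^ dUp (i :: v) (j :: w) * y ^ dUp (j :: w) (i :: v) =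
        x ^ v.length * (x * y * depthSum y (f j)) := fun i j v h => by
    rw [depthSum, mul_finsum_mem, mul_finsum_mem]
    refine finsum_mem_congr rfl fun w _ => ?_
    have h' : (i : ℕ) ≠ j := fun e => h (Fin.ext e)
    rw [dUp_cons_of_ne h', dUp_cons_of_ne h'.symm]
    ring
  have hi : ∀ i : Fin k, ∑ᶠ v ∈ vertexSet (f i), ∑ᶠ w ∈ vertexSet (graft f),
      x ^ dUp (i :: v) w * y ^ dUp w (i :: v) = x * depthSum x (f i) + pairSum x y (f i) +
        ∑ j ∈ Finset.univ.erase i, x * y * (depthSum x (f i) * depthSum y (f j)) := fun i => by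
    have : ∀ v : List ℕ, ∑ᶠ w ∈ vertexSet (graft f), x ^ dUp (i :: v) w * y ^ dUp w (i :: v) =
        x * x ^ v.length + ∑ᶠ w ∈ vertexSet (f i), x ^ dUp v w * y ^ dUp w v +
          x ^ v.length * ∑ j ∈ Finset.univ.erase i, x * y * depthSum y (f j) := fun v => by
      rw [finsum_mem_vertexSet_graft, ← Finset.add_sum_erase _ _ (Finset.mem_univ i),
        Finset.sum_congr rfl fun j hj => hij i j v (Finset.ne_of_mem_erase hj).symm,
        ← Finset.mul_sum]
      simp only [dUp_nil_left, dUp_nil_right, dUp_cons_self, List.length_cons, pow_succ', pow_zero,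
        mul_one, add_assoc]
    have hfin := finite_vertexSet (f i)
    rw [finsum_mem_congr rfl fun v _ => this v, finsum_mem_add_distrib hfin,
      finsum_mem_add_distrib hfin, ← mul_finsum_mem, ← finsum_mem_mul, pairSum,
      Finset.mul_sum]
    congr 1
    exact Finset.sum_congr rfl fun j _ => by simp only [depthSum]; ring
  rw [pairSum, finsum_mem_vertexSet_graft, hroot, Finset.sum_congr rfl fun i _ => hi i,
    Finset.sum_add_distrib, Finset.sum_add_distrib]
  ring

lemma one_add_sum_le_prod {ι : Type*} (s : Finset ι) {g : ι → ℝ} (hg : ∀ i, 0 ≤ g i) :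
    1 + ∑ i ∈ s, g i ≤ ∏ i ∈ s, (1 + g i) := by
  induction s using Finset.cons_induction with
  | empty => simp
  | cons i s hi ih =>
    rw [Finset.sum_cons, Finset.prod_cons]
    have h0 : 0 ≤ ∑ i ∈ s, g i := Finset.sum_nonneg fun i _ => hg i
    nlinarith [hg i, mul_le_mul_of_nonneg_left ih (hg i), mul_nonneg (hg i) h0]

lemma depthSum_nonneg {x : ℝ} (hx : 0 ≤ x) (t : PlaneTree) : 0 ≤ depthSum x t :=
  finsum_nonneg fun _ => finsum_nonneg fun _ => pow_nonneg hx _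

lemma depthSum_two_le (t : PlaneTree) : 1 + 2 * depthSum (2 : ℝ) t ≤ 3 ^ size t := by
  induction t using induction_graft with
  | hP k f ih =>
    have h0 : ∀ i, 0 ≤ 2 * depthSum (2 : ℝ) (f i) := fun i => by
      have := depthSum_nonneg (zero_le_two (α := ℝ)) (f i)
      positivity
    rw [depthSum_graft, size_graft, pow_add, pow_one, ← Finset.prod_pow_eq_pow_sum]
    have h1 := one_add_sum_le_prod Finset.univ h0
    have h2 : ∏ i, (1 + 2 * depthSum (2 : ℝ) (f i)) ≤ ∏ i, 3 ^ size (f i) :=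
      Finset.prod_le_prod (fun i _ => by linarith [h0 i]) fun i _ => ih i
    have h3 : 0 ≤ ∑ i, 2 * depthSum (2 : ℝ) (f i) := Finset.sum_nonneg fun i _ => h0 i
    linarith

lemma norm_finsum_mem_le {α : Type*} {s : Set α} (hs : s.Finite) {g : α → ℂ} {b : α → ℝ}
    (hgb : ∀ v, ‖g v‖ ≤ b v) : ‖∑ᶠ v ∈ s, g v‖ ≤ ∑ᶠ v ∈ s, b v := by
  rw [finsum_mem_eq_finite_toFinset_sum _ hs, finsum_mem_eq_finite_toFinset_sum _ hs]
  exact norm_sum_le_of_le _ fun v _ => hgb v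

lemma norm_pow_le_two_pow {x : ℂ} (hx : ‖x‖ ≤ 2) {m n : ℕ} (hmn : m ≤ n) :
    ‖x ^ m‖ ≤ (2 : ℝ) ^ n := by
  rw [norm_pow]
  exact (pow_le_pow_left₀ (norm_nonneg _) hx m).trans (pow_le_pow_right₀ one_le_two hmn)

lemma norm_depthSum_le {x : ℂ} (hx : ‖x‖ ≤ 2) (t : PlaneTree) :
    ‖depthSum x t‖ ≤ depthSum (2 : ℝ) t :=
  norm_finsum_mem_le (finite_vertexSet t) fun _ => norm_pow_le_two_pow hx le_rfl

lemma norm_depthSum_le_pow {x : ℂ} (hx : ‖x‖ ≤ 2) (t : PlaneTree) :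
    ‖depthSum x t‖ ≤ 9 ^ size t := by
  have h1 := norm_depthSum_le hx t
  have h2 := depthSum_two_le t
  have h3 : (3 : ℝ) ^ size t ≤ 9 ^ size t := by gcongr; norm_num
  linarith [norm_nonneg (depthSum x t)]

lemma norm_pairSum_le_pow {x y : ℂ} (hx : ‖x‖ ≤ 2) (hy : ‖y‖ ≤ 2) (t : PlaneTree) :
    ‖pairSum x y t‖ ≤ 9 ^ size t := by
  have hfin := finite_vertexSet t
  have h0 := depthSum_nonneg (zero_le_two (α := ℝ)) t
  have h1 : ‖pairSum x y t‖ ≤ depthSum (2 : ℝ) t * depthSum (2 : ℝ) t := by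
    nth_rewrite 1 [depthSum]
    rw [finsum_mem_mul]
    refine norm_finsum_mem_le hfin fun v => ?_
    rw [depthSum, mul_finsum_mem]
    refine norm_finsum_mem_le hfin fun w => ?_
    rw [norm_mul]
    exact mul_le_mul (norm_pow_le_two_pow hx (dUp_le _ _)) (norm_pow_le_two_pow hy (dUp_le _ _))
      (norm_nonneg _) (by positivity)
  have h2 : depthSum (2 : ℝ) t ≤ 3 ^ size t := by linarith [depthSum_two_le t]
  refine h1.trans ((mul_le_mul h2 h2 h0 (by positivity)).trans_eq ?_)
  rw [← mul_pow]; norm_num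

end PlaneTree

open PlaneTree in
lemma gwProb_graft (p : ℕ → ℝ≥0∞) {k : ℕ} (f : Fin k → PlaneTree) :
    gwProb p (graft f) = p k * ∏ i, gwProb p (f i) := by
  simp only [gwProb, finprod_mem_vertexSet_graft, childCount_graft_nil, childCount_graft_cons]

section TupleSums

variable {T : Type*} {k : ℕ}

lemma ENNReal.tsum_fin_prod (g : T → ℝ≥0∞) (k : ℕ) :
    ∑' f : Fin k → T, ∏ i, g (f i) = (∑' t, g t) ^ k := by
  induction k with
  | zero => simp
  | succ k ih =>
    rw [← (Fin.consEquiv fun _ : Fin (k + 1) => T).tsum_eq, ENNReal.tsum_prod']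
    simp only [Fin.consEquiv_apply, Fin.prod_univ_succ, Fin.cons_zero, Fin.cons_succ,
      ENNReal.tsum_mul_left, ih, ENNReal.tsum_mul_right, pow_succ']

lemma hasSum_mul_complex {T' : Type*} {f : T → ℂ} {g : T' → ℂ} {s s' : ℂ} (hf : HasSum f s)
    (hg : HasSum g s') : HasSum (fun x : T × T' => f x.1 * g x.2) (s * s') :=
  hf.mul hg (summable_mul_of_summable_norm (summable_norm_iff.2 hf.summable)
    (summable_norm_iff.2 hg.summable))

lemma hasSum_fin_prod {g : Fin k → T → ℂ} {S : Fin k → ℂ} (hg : ∀ i, HasSum (g i) (S i)) :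
    HasSum (fun f : Fin k → T => ∏ i, g i (f i)) (∏ i, S i) := by
  induction k with
  | zero => simp
  | succ k ih =>
    have h0 : HasSum (g 0) (S 0) := hg 0
    have h1 : HasSum (fun f : Fin k → T => ∏ i, g i.succ (f i)) (∏ i : Fin k, S i.succ) :=
      ih fun i => hg i.succ
    have hmul := hasSum_mul_complex h0 h1
    let e : T × (Fin k → T) ≃ (Fin (k + 1) → T) := Fin.consEquiv fun _ => T
    rw [← e.hasSum_iff, Fin.prod_univ_succ]
    convert hmul using 2 with x
    simp [e, Fin.prod_univ_succ]

variable {w A B : T → ℂ} {F G H : ℂ}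

lemma hasSum_fin_prod_const (hF : HasSum w F) (k : ℕ) :
    HasSum (fun f : Fin k → T => ∏ i, w (f i)) (F ^ k) := by
  simpa using hasSum_fin_prod (k := k) (fun _ => hF)

lemma hasSum_fin_prod_mul_sum (hF : HasSum w F) (hG : HasSum (fun t => w t * A t) G) (k : ℕ) :
    HasSum (fun f : Fin k → T => (∏ i, w (f i)) * ∑ i, A (f i)) (k * F ^ (k - 1) * G) := by
  have key : ∀ i : Fin k, HasSum (fun f : Fin k → T => (∏ j, w (f j)) * A (f i))
      (F ^ (k - 1) * G) := fun i => by
    have := hasSum_fin_prod (k := k) (g := fun j t => w t * if j = i then A t else 1)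
      (S := fun j => if j = i then G else F)
      (fun j => by by_cases hj : j = i <;> simp [hj, hF, hG])
    simp only [Finset.prod_mul_distrib, Finset.prod_ite_eq', Finset.mem_univ, if_true] at this
    convert this using 1
    rw [← Finset.mul_prod_erase _ _ (Finset.mem_univ i), if_pos rfl,
      Finset.prod_congr rfl fun j hj => if_neg (Finset.ne_of_mem_erase hj)]
    simp [mul_comm]
  have := hasSum_sum fun i (_ : i ∈ Finset.univ) => key i
  simpa [Finset.mul_sum, mul_assoc] using this

lemma hasSum_fin_prod_mul_sum_sum (hF : HasSum w F) (hG : HasSum (fun t => w t * A t) G)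
    (hH : HasSum (fun t => w t * B t) H) (k : ℕ) :
    HasSum (fun f : Fin k → T => (∏ i, w (f i)) *
      ∑ i, ∑ j ∈ Finset.univ.erase i, A (f i) * B (f j))
      (k * (k - 1 : ℕ) * F ^ (k - 2) * (G * H)) := by
  have key : ∀ i j : Fin k, j ∈ Finset.univ.erase i → HasSum (fun f : Fin k → T =>
      (∏ l, w (f l)) * (A (f i) * B (f j))) (F ^ (k - 2) * (G * H)) := fun i j hj => by
    have hji := Finset.ne_of_mem_erase hj
    have := hasSum_fin_prod (k := k)
      (g := fun l t => w t * ((if l = i then A t else 1) * if l = j then B t else 1))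
      (S := fun l => if l = i then G else if l = j then H else F)
      (fun l => by
        by_cases hl : l = i
        · subst hl; simp [hji.symm, hG]
        · by_cases hl' : l = j
          · subst hl'; simp [hl, hH]
          · simp [hl, hl', hF])
    simp only [Finset.prod_mul_distrib, Finset.prod_ite_eq', Finset.mem_univ, if_true] at this
    convert this using 1
    rw [← Finset.mul_prod_erase _ _ (Finset.mem_univ i), if_pos rfl,
      Finset.prod_congr rfl fun l hl => if_neg (Finset.ne_of_mem_erase hl),
      ← Finset.mul_prod_erase _ _ hj, if_pos rfl,
      Finset.prod_congr rfl fun l hl => if_neg (Finset.ne_of_mem_erase hl), Finset.prod_const,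
      Finset.card_erase_of_mem hj, Finset.card_erase_of_mem (Finset.mem_univ i), Finset.card_univ,
      Fintype.card_fin, Nat.sub_sub]
    ring
  have := hasSum_sum fun i (_ : i ∈ Finset.univ) => hasSum_sum fun j hj => key i j hj
  simp only [← Finset.mul_sum, Finset.sum_const, Finset.card_erase_of_mem (Finset.mem_univ _),
    Finset.card_univ, Fintype.card_fin, nsmul_eq_mul] at this
  convert this using 1
  · simp only [Finset.mul_sum]
  · ring

end TupleSums

section PgfShift

variable {c : ℕ → ℝ} {u : ℂ}

lemma hasSum_of_shift {e : ℕ → ℂ} {s : ℂ}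
    (h : HasSum (fun k => e (k + 1)) s) (h0 : e 0 = 0) : HasSum e s := by
  rw [← hasSum_nat_add_iff' 1]
  simpa [h0] using h

lemma hasSum_pgf_dcoeff (hc : ∀ k, 0 ≤ c k) (hs : Summable (dcoeff c)) (hu : ‖u‖ ≤ 1) :
    HasSum (fun k => (c k : ℂ) * (k * u ^ (k - 1))) (pgf (dcoeff c) u) := by
  refine hasSum_of_shift ?_ (by simp)
  convert hasSum_pgf (dcoeff_nonneg hc) hs hu using 2 with k
  simp only [dcoeff, Nat.add_sub_cancel]
  push_cast
  ring

lemma hasSum_pgf_dcoeff_dcoeff (hc : ∀ k, 0 ≤ c k) (hs : Summable (dcoeff (dcoeff c)))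
    (hu : ‖u‖ ≤ 1) : HasSum (fun k => (c k : ℂ) * (k * (k - 1 : ℕ) * u ^ (k - 2)))
      (pgf (dcoeff (dcoeff c)) u) := by
  refine hasSum_of_shift ?_ (by simp)
  convert hasSum_pgf_dcoeff (dcoeff_nonneg hc) hs hu using 2 with k
  simp only [dcoeff, Nat.add_sub_cancel, show k + 1 - 2 = k - 1 by omega]
  push_cast
  ring

end PgfShift

open PlaneTree

lemma PlaneTree.size_pos (t : PlaneTree) : 0 < size t := by
  induction t using induction_graft with
  | hP k f ih => rw [size_graft]; omega

/-- Real-valued version of an offspring distribution. -/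
noncomputable def offspringMass (p : ℕ → ℝ≥0∞) (k : ℕ) : ℝ := (p k).toReal

/-- Real-valued version of `probSize`. -/
noncomputable def sizeMass (p : ℕ → ℝ≥0∞) (n : ℕ) : ℝ := (probSize p n).toReal

/-- The contribution of a tree to the generating function of the total progeny. -/
noncomputable def treeWeight (p : ℕ → ℝ≥0∞) (z : ℂ) (t : PlaneTree) : ℂ :=
  (gwProb p t).toReal * z ^ size t

lemma treeWeight_graft (p : ℕ → ℝ≥0∞) (z : ℂ) {k : ℕ} (f : Fin k → PlaneTree) :
    treeWeight p z (graft f) = offspringMass p k * z * ∏ i, treeWeight p z (f i) := by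
  simp only [treeWeight, offspringMass, gwProb_graft, size_graft, ENNReal.toReal_mul,
    ENNReal.toReal_prod, Finset.prod_mul_distrib, Finset.prod_pow_eq_pow_sum, pow_add, pow_one]
  push_cast
  ring

lemma hasSum_of_graft {φ : PlaneTree → ℂ} {s : ℂ} (hφ : HasSum φ s) {g : ℕ → ℂ}
    (hg : ∀ k, HasSum (fun f : Fin k → PlaneTree => φ (graft f)) (g k)) : HasSum g s :=
  (graftEquiv.hasSum_iff.2 hφ).sigma hg

lemma hasSum_size_fiber {p : ℕ → ℝ≥0∞} {z : ℂ} {φ : PlaneTree → ℂ} {s : ℂ}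
    (hφ : HasSum (fun t => treeWeight p z t * φ t) s) :
    HasSum (fun n => (∑' t, ((if size t = n then (gwProb p t).toReal else 0 : ℝ) : ℂ) * φ t) *
      z ^ n) s := by
  refine (hφ.tsum_fiberwise size).congr_fun fun n => ?_
  rw [tsum_subtype (size ⁻¹' {n}) fun t => treeWeight p z t * φ t, ← tsum_mul_right]
  refine tsum_congr fun t => ?_
  by_cases ht : size t = n
  · rw [if_pos ht, Set.indicator_of_mem (by simpa using ht), treeWeight, ht]
    ring
  · rw [if_neg ht, Set.indicator_of_notMem (by simpa using ht)]
    simp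

section GaltonWatson

variable {p : ℕ → ℝ≥0∞} (hp : ∑' k : ℕ, p k = 1)
include hp

lemma tsum_gwProb_size_le (N : ℕ) :
    ∑' t : PlaneTree, (if size t ≤ N then gwProb p t else 0) ≤ 1 := by
  induction N with
  | zero => simp [(size_pos _).ne']
  | succ N ih =>
    rw [← graftEquiv.tsum_eq, ENNReal.tsum_sigma']
    refine (ENNReal.tsum_le_tsum fun k => ?_).trans_eq hp
    calc ∑' f : Fin k → PlaneTree, (if size (graft f) ≤ N + 1 then gwProb p (graft f) else 0)
        ≤ ∑' f : Fin k → PlaneTree, p k * ∏ i, if size (f i) ≤ N then gwProb p (f i) else 0 := by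
          refine ENNReal.tsum_le_tsum fun f => ?_
          split_ifs with hf
          · rw [gwProb_graft]
            refine mul_le_mul_right (Finset.prod_le_prod' fun i _ => ?_) _
            rw [if_pos]
            rw [size_graft] at hf
            have := Finset.single_le_sum (f := fun i => size (f i)) (fun i _ => Nat.zero_le _)
              (Finset.mem_univ i)
            omega
          · exact zero_le
      _ = p k * (∑' t, if size t ≤ N then gwProb p t else 0) ^ k := by
          rw [ENNReal.tsum_mul_left,
            ENNReal.tsum_fin_prod fun t => if size t ≤ N then gwProb p t else 0]
      _ ≤ p k := mul_le_of_le_one_right' (pow_le_one₀ zero_le ih)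

lemma tsum_gwProb_le_one : ∑' t, gwProb p t ≤ 1 := by
  rw [ENNReal.tsum_eq_iSup_sum]
  refine iSup_le fun s => le_trans ?_ (tsum_gwProb_size_le hp (s.sup size))
  refine le_trans (Finset.sum_le_sum fun t ht => ?_) (ENNReal.sum_le_tsum s)
  rw [if_pos (Finset.le_sup ht)]

lemma gwProb_ne_top (t : PlaneTree) : gwProb p t ≠ ⊤ :=
  ne_top_of_le_ne_top ENNReal.one_ne_top ((ENNReal.le_tsum t).trans (tsum_gwProb_le_one hp))

lemma summable_toReal_gwProb : Summable fun t => (gwProb p t).toReal :=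
  ENNReal.summable_toReal (ne_top_of_le_ne_top ENNReal.one_ne_top (tsum_gwProb_le_one hp))

lemma tsum_probSize_le_one : ∑' n, probSize p n ≤ 1 := by
  simp only [probSize]
  rw [ENNReal.tsum_comm]
  simpa using tsum_gwProb_le_one hp

lemma probSize_ne_top (n : ℕ) : probSize p n ≠ ⊤ :=
  ne_top_of_le_ne_top ENNReal.one_ne_top ((ENNReal.le_tsum n).trans (tsum_probSize_le_one hp))

lemma summable_sizeMass : Summable (sizeMass p) :=
  ENNReal.summable_toReal (ne_top_of_le_ne_top ENNReal.one_ne_top (tsum_probSize_le_one hp))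

lemma tsum_sizeMass_le_one : ∑' n, sizeMass p n ≤ 1 := by
  rw [← ENNReal.toReal_one]
  simp only [sizeMass]
  rw [← ENNReal.tsum_toReal_eq (probSize_ne_top hp)]
  exact ENNReal.toReal_mono ENNReal.one_ne_top (tsum_probSize_le_one hp)

lemma sizeMass_eq_tsum (n : ℕ) :
    sizeMass p n = ∑' t, if size t = n then (gwProb p t).toReal else 0 := by
  rw [sizeMass, probSize, ENNReal.tsum_toReal_eq fun t => by
    split_ifs; exacts [gwProb_ne_top hp t, ENNReal.zero_ne_top]]
  exact tsum_congr fun t => by split_ifs <;> simp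

lemma summable_treeWeight_mul {z : ℂ} {φ : PlaneTree → ℂ} {r : ℝ} (hφ : ∀ t, ‖φ t‖ ≤ r ^ size t)
    (hz : ‖z‖ * r ≤ 1) (hr : 0 ≤ r) : Summable fun t => treeWeight p z t * φ t := by
  refine Summable.of_norm_bounded (summable_toReal_gwProb hp) fun t => ?_
  rw [treeWeight, norm_mul, norm_mul, Complex.norm_real, norm_pow,
    Real.norm_of_nonneg ENNReal.toReal_nonneg, mul_assoc]
  refine mul_le_of_le_one_right ENNReal.toReal_nonneg ?_
  calc ‖z‖ ^ size t * ‖φ t‖ ≤ ‖z‖ ^ size t * r ^ size t := by gcongr; exact hφ t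
    _ = (‖z‖ * r) ^ size t := (mul_pow _ _ _).symm
    _ ≤ 1 := pow_le_one₀ (by positivity) hz

lemma hasSum_treeWeight {z : ℂ} (hz : ‖z‖ ≤ 1) :
    HasSum (treeWeight p z) (pgf (sizeMass p) z) := by
  have hs : Summable fun t => treeWeight p z t * 1 :=
    summable_treeWeight_mul hp (φ := fun _ => 1) (r := 1) (by simp) (by simpa using hz) zero_le_one
  have h1 := hasSum_size_fiber hs.hasSum
  have h2 : HasSum (fun n => (sizeMass p n : ℂ) * z ^ n) (∑' t, treeWeight p z t * 1) := by
    convert h1 using 3 with n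
    rw [sizeMass_eq_tsum hp, Complex.ofReal_tsum]
    exact tsum_congr fun t => (mul_one _).symm
  rw [pgf, h2.tsum_eq]
  simpa using hs.hasSum

lemma summable_offspringMass : Summable (offspringMass p) :=
  ENNReal.summable_toReal (by rw [hp]; exact ENNReal.one_ne_top)

lemma offspring_ne_top (k : ℕ) : p k ≠ ⊤ :=
  ne_top_of_le_ne_top ENNReal.one_ne_top ((ENNReal.le_tsum k).trans hp.le)

lemma pgf_sizeMass_eq {z : ℂ} (hz : ‖z‖ ≤ 1) :
    pgf (sizeMass p) z = z * pgf (offspringMass p) (pgf (sizeMass p) z) := by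
  have hF := hasSum_treeWeight hp hz
  have hF1 : ‖pgf (sizeMass p) z‖ ≤ 1 :=
    (norm_pgf_le (fun _ => ENNReal.toReal_nonneg) (summable_sizeMass hp) hz).trans
      (tsum_sizeMass_le_one hp)
  have h1 := hasSum_of_graft hF fun k => by
    simpa only [treeWeight_graft] using
      (hasSum_fin_prod_const hF k).mul_left (offspringMass p k * z : ℂ)
  have h2 := (hasSum_pgf (c := offspringMass p) (fun _ => ENNReal.toReal_nonneg)
    (summable_offspringMass hp) hF1).mul_left z
  refine h1.unique ?_
  exact h2.congr_fun fun k => by ring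

end GaltonWatson

lemma size_modEq_one {p : ℕ → ℝ≥0∞} {d : ℕ} (hd : ∀ k, p k ≠ 0 → d ∣ k) (t : PlaneTree)
    (ht : gwProb p t ≠ 0) : size t ≡ 1 [MOD d] := by
  induction t using induction_graft with
  | hP k f ih =>
    rw [gwProb_graft, mul_ne_zero_iff, Finset.prod_ne_zero_iff] at ht
    have h1 : ∑ i, size (f i) ≡ ∑ _i : Fin k, 1 [MOD d] :=
      Nat.ModEq.sum fun i _ => ih i (ht.2 i (Finset.mem_univ i))
    have h2 : k ≡ 0 [MOD d] := (Nat.modEq_zero_iff_dvd).2 (hd k ht.1)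
    rw [size_graft]
    simp only [Finset.sum_const, Finset.card_univ, Fintype.card_fin, smul_eq_mul, mul_one] at h1
    exact (h1.trans h2).add_left 1

section Criticality

variable {p : ℕ → ℝ≥0∞} (hp : ∑' k : ℕ, p k = 1) (hmean : ∑' k : ℕ, (k : ℝ≥0∞) * p k = 1)
include hp

lemma hasSum_offspringMass : HasSum (offspringMass p) 1 := by
  have := (summable_offspringMass hp).hasSum
  simp only [offspringMass] at this
  rw [← ENNReal.tsum_toReal_eq (offspring_ne_top hp), hp, ENNReal.toReal_one] at this
  exact this

include hmean

lemma hasSum_mul_offspringMass : HasSum (fun k : ℕ => k * offspringMass p k) 1 := by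
  have hs : Summable fun k : ℕ => ((k : ℝ≥0∞) * p k).toReal :=
    ENNReal.summable_toReal (by rw [hmean]; exact ENNReal.one_ne_top)
  have := hs.hasSum
  rw [← ENNReal.tsum_toReal_eq fun k => ENNReal.mul_ne_top (ENNReal.natCast_ne_top k)
    (offspring_ne_top hp k), hmean, ENNReal.toReal_one] at this
  simpa only [ENNReal.toReal_mul, ENNReal.toReal_natCast, offspringMass] using this

lemma hasSum_dcoeff_offspringMass : HasSum (dcoeff (offspringMass p)) 1 := by
  have := (hasSum_nat_add_iff' 1).2 (hasSum_mul_offspringMass hp hmean)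
  exact (by simpa using this : HasSum (fun n : ℕ => ((n : ℝ) + 1) * offspringMass p (n + 1)) 1)

lemma hasSum_dcoeff_dcoeff_offspringMass (hvar_fin : xiVar p ≠ ⊤) :
    HasSum (dcoeff (dcoeff (offspringMass p))) (xiVar p).toReal := by
  have hV : HasSum (fun k : ℕ => offspringMass p k * ((k : ℝ) - 1) ^ 2) (xiVar p).toReal := by
    have := (ENNReal.summable_toReal hvar_fin).hasSum
    rw [← ENNReal.tsum_toReal_eq fun k => ENNReal.mul_ne_top (offspring_ne_top hp k)
      ENNReal.ofReal_ne_top] at this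
    simpa only [ENNReal.toReal_mul, ENNReal.toReal_ofReal (sq_nonneg _), xiVar,
      offspringMass] using this
  have h1 := ((hV.add (hasSum_mul_offspringMass hp hmean)).sub (hasSum_offspringMass hp))
  rw [add_sub_cancel_right, ← hasSum_nat_add_iff' 2] at h1
  simp only [Finset.sum_range_succ, Finset.sum_range_zero] at h1
  norm_num at h1
  refine h1.congr_fun fun k => ?_
  simp only [dcoeff]
  push_cast
  ring

lemma exists_isCriticalTreeSeries (hvar_pos : 0 < xiVar p) (hvar_fin : xiVar p ≠ ⊤) :
    ∃ d, IsCriticalTreeSeries (offspringMass p) (sizeMass p) d := by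
  have hne : ∀ k, offspringMass p k ≠ 0 ↔ p k ≠ 0 := fun k => by
    simp [offspringMass, ENNReal.toReal_eq_zero_iff, offspring_ne_top hp k]
  have h1 := hasSum_offspringMass hp
  have h2 := hasSum_dcoeff_offspringMass hp hmean
  have h3 := hasSum_dcoeff_dcoeff_offspringMass hp hmean hvar_fin
  have hdvd : ∀ k, p k ≠ 0 → Nat.setGcd {k | p k ≠ 0} ∣ k := fun k hk => Nat.setGcd_dvd_of_mem hk
  refine ⟨Nat.setGcd {k | p k ≠ 0}, ?_⟩
  constructor
  case q_nonneg => exact fun _ => ENNReal.toReal_nonneg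
  case q_summable => exact h1.summable
  case q_tsum => exact h1.tsum_eq
  case dq_summable => exact h2.summable
  case dq_tsum => exact h2.tsum_eq
  case ddq_summable => exact h3.summable
  case ddq_pos => rw [h3.tsum_eq]; exact ENNReal.toReal_pos hvar_pos.ne' hvar_fin
  case a_nonneg => exact fun _ => ENNReal.toReal_nonneg
  case a_summable => exact summable_sizeMass hp
  case a_tsum_le => exact tsum_sizeMass_le_one hp
  case eqn => exact fun z hz => pgf_sizeMass_eq hp hz
  case d_ne_zero =>
    rw [Ne, Nat.setGcd_eq_zero_iff]
    intro hsub
    have : ∑' k : ℕ, (k : ℝ≥0∞) * p k = 0 := by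
      rw [ENNReal.tsum_eq_zero]
      intro k
      by_cases hk : p k = 0
      · simp [hk]
      · rw [show k = 0 from hsub hk]; simp
    exact zero_ne_one (this.symm.trans hmean)
  case dvd_of_ne_zero => exact fun k hk => hdvd k ((hne k).1 hk)
  case pow_eq_one =>
    intro u hu
    rw [← orderOf_dvd_iff_pow_eq_one, Nat.dvd_setGcd_iff]
    exact fun k hk => orderOf_dvd_of_pow_eq_one (hu k ((hne k).2 hk))
  case modEq_of_ne_zero =>
    intro n hn
    have : probSize p n ≠ 0 := fun h0 => hn (by rw [sizeMass, h0, ENNReal.toReal_zero])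
    rw [probSize, Ne, ENNReal.tsum_eq_zero, not_forall] at this
    obtain ⟨t, ht⟩ := this
    split_ifs at ht with hts
    · rw [← hts]; exact size_modEq_one hdvd t ht
    · exact absurd rfl ht

end Criticality

section PairGen

variable {p : ℕ → ℝ≥0∞} {d : ℕ} {x y z : ℂ}

lemma one_sub_mul_spineGen_ne_zero (h : IsCriticalTreeSeries (offspringMass p) (sizeMass p) d)
    (hx : ‖x‖ ≤ 2) (hz : ‖z‖ ≤ 1 / 9) :
    1 - x * spineGen (offspringMass p) (sizeMass p) z ≠ 0 := fun h0 => by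
  have h1 := h.norm_dq_le (h.norm_a_le (hz.trans (by norm_num)))
  have h2 : ‖x * spineGen (offspringMass p) (sizeMass p) z‖ ≤ 2 * (1 / 9 * 1) := by
    rw [spineGen, norm_mul, norm_mul]
    gcongr
  rw [← sub_eq_zero.1 h0, norm_one] at h2
  norm_num at h2

variable (hp : ∑' k : ℕ, p k = 1)
  (h : IsCriticalTreeSeries (offspringMass p) (sizeMass p) d)
include hp h

lemma hasSum_depthSum (hx : ‖x‖ ≤ 2) (hz : ‖z‖ ≤ 1 / 9) :
    HasSum (fun t => treeWeight p z t * depthSum x t)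
      (pathGen (offspringMass p) (sizeMass p) x z) := by
  have hz1 : ‖z‖ ≤ 1 := hz.trans (by norm_num)
  have hF := hasSum_treeWeight hp hz1
  have hG := (summable_treeWeight_mul hp (norm_depthSum_le_pow hx) (z := z) (by linarith)
    (by norm_num)).hasSum
  set F := pgf (sizeMass p) z with hFdef
  set G := ∑' t, treeWeight p z t * depthSum x t with hGdef
  have h1 := hasSum_of_graft hG fun k => by
    have := ((hasSum_fin_prod_const hF k).add
      ((hasSum_fin_prod_mul_sum hF hG k).mul_left x)).mul_left (offspringMass p k * z : ℂ)
    refine this.congr_fun fun f => ?_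
    rw [treeWeight_graft, depthSum_graft, ← Finset.mul_sum]
    ring
  have hF1 : ‖F‖ ≤ 1 := h.norm_a_le hz1
  have h2 := ((hasSum_pgf h.q_nonneg h.q_summable hF1).mul_left z).add
    ((hasSum_pgf_dcoeff h.q_nonneg h.dq_summable hF1).mul_left (z * x * G))
  have h3 := h1.unique (h2.congr_fun fun k => by ring)
  rw [← h.eqn z hz1] at h3
  have h4 : G = pathGen (offspringMass p) (sizeMass p) x z := by
    rw [pathGen, eq_div_iff (one_sub_mul_spineGen_ne_zero h hx hz), spineGen]
    linear_combination h3
  rwa [h4] at hG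

lemma hasSum_pairSum (hx : ‖x‖ ≤ 2) (hy : ‖y‖ ≤ 2) (hz : ‖z‖ ≤ 1 / 9) :
    HasSum (fun t => treeWeight p z t * pairSum x y t)
      (pairGen (offspringMass p) (sizeMass p) x y z) := by
  have hz1 : ‖z‖ ≤ 1 := hz.trans (by norm_num)
  have hF := hasSum_treeWeight hp hz1
  have hGx := hasSum_depthSum hp h hx hz
  have hGy := hasSum_depthSum hp h hy hz
  have hH := (summable_treeWeight_mul hp (norm_pairSum_le_pow hx hy) (z := z) (by linarith)
    (by norm_num)).hasSum
  have ex : pathGen (offspringMass p) (sizeMass p) x z *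
      (1 - x * spineGen (offspringMass p) (sizeMass p) z) = pgf (sizeMass p) z :=
    div_mul_cancel₀ _ (one_sub_mul_spineGen_ne_zero h hx hz)
  have ey : pathGen (offspringMass p) (sizeMass p) y z *
      (1 - y * spineGen (offspringMass p) (sizeMass p) z) = pgf (sizeMass p) z :=
    div_mul_cancel₀ _ (one_sub_mul_spineGen_ne_zero h hy hz)
  set F := pgf (sizeMass p) z with hFdef
  set Gx := pathGen (offspringMass p) (sizeMass p) x z with hGxdef
  set Gy := pathGen (offspringMass p) (sizeMass p) y z with hGydef
  set H := ∑' t, treeWeight p z t * pairSum x y t with hHdef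
  have h1 := hasSum_of_graft hH fun k => by
    have := (((((hasSum_fin_prod_const hF k).add
      ((hasSum_fin_prod_mul_sum hF hGy k).mul_left y)).add
      ((hasSum_fin_prod_mul_sum hF hGx k).mul_left x)).add
      (hasSum_fin_prod_mul_sum hF hH k)).add
      ((hasSum_fin_prod_mul_sum_sum hF hGx hGy k).mul_left (x * y))).mul_left
        (offspringMass p k * z : ℂ)
    refine this.congr_fun fun f => ?_
    rw [treeWeight_graft, pairSum_graft]
    simp only [← Finset.mul_sum]
    ring
  have hF1 : ‖F‖ ≤ 1 := h.norm_a_le hz1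
  have h2 := (((hasSum_pgf h.q_nonneg h.q_summable hF1).mul_left z).add
    ((hasSum_pgf_dcoeff h.q_nonneg h.dq_summable hF1).mul_left (z * (y * Gy + x * Gx + H)))).add
    ((hasSum_pgf_dcoeff_dcoeff h.q_nonneg h.ddq_summable hF1).mul_left (z * x * y * Gx * Gy))
  have h3 := h1.unique (h2.congr_fun fun k => by ring)
  rw [← h.eqn z hz1] at h3
  have h4 : H = pairGen (offspringMass p) (sizeMass p) x y z := by
    rw [pairGen, eq_div_iff (h.one_sub_spineGen_ne_zero (hz.trans_lt (by norm_num)))]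
    rw [spineGen] at ex ey ⊢
    linear_combination h3 - ex - ey
  rwa [h4] at hH

lemma hasCoeffs_pairGen (hx : ‖x‖ ≤ 2) (hy : ‖y‖ ≤ 2) :
    HasCoeffs (pairGen (offspringMass p) (sizeMass p) x y) fun n =>
      ∑' t, ((if size t = n then (gwProb p t).toReal else 0 : ℝ) : ℂ) * pairSum x y t := by
  filter_upwards [Metric.closedBall_mem_nhds (0 : ℂ) (by norm_num : (0 : ℝ) < 1 / 9)] with z hz
  exact hasSum_size_fiber (hasSum_pairSum hp h hx hy (by simpa using hz))

end PairGen

/-- Theorem 3 of Devroye–Janson.  There are constants `C, β, δ > 0` such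
that `|h_n(x, y)| ≤ C n |1 - x|⁻¹ |1 - y|⁻¹` for all `n ≥ 1` and all `x, y ∈ Δ(β, δ)`. -/
theorem hGen_bound
    (p : ℕ → ℝ≥0∞) (hp : ∑' k : ℕ, p k = 1)
    (hmean : ∑' k : ℕ, (k : ℝ≥0∞) * p k = 1)
    (hvar_pos : 0 < xiVar p) (hvar_fin : xiVar p ≠ ⊤) :
    ∃ C β δ : ℝ, 0 < C ∧ 0 < β ∧ β < Real.pi / 2 ∧ 0 < δ ∧
      ∀ n : ℕ, 1 ≤ n → probSize p n ≠ 0 →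
        ∀ x ∈ Delta β δ, ∀ y ∈ Delta β δ,
          ‖hGen p n x y‖ ≤ C * n / (‖1 - x‖ * ‖1 - y‖) := by
  obtain ⟨d, h⟩ := exists_isCriticalTreeSeries hp hmean hvar_pos hvar_fin
  obtain ⟨C, β, δ, hC, hβ, hβ', hδ, hδ1, key⟩ := h.exists_coeff_bound
  refine ⟨C, β, δ, hC, hβ, hβ', hδ, fun n hn hpn x hx y hy => ?_⟩
  have hle : ∀ x ∈ Delta β δ, ‖x‖ ≤ 2 := fun x hx => by linarith [hx.1]
  have han : sizeMass p n ≠ 0 := (ENNReal.toReal_pos hpn (probSize_ne_top hp n)).ne'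
  refine le_trans (le_of_eq ?_)
    (key x hx y hy _ (hasCoeffs_pairGen hp h (hle x hx) (hle y hy)) n hn han)
  rw [hGen, norm_div, Complex.norm_real, Real.norm_of_nonneg ENNReal.toReal_nonneg]
  rfl
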